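/- Let S be a Euclidean surface with conical singularities {s_1,...,s_l, s_{l+1},...,s_n} where θ(s_i) ∈ (0,π) for i = 1,...,l and θ(s_i) ∈ (2π,∞) for i = l+1,...,n, l ≤ n. Then there exists a positive real number C such that for every geodesic g in S with no homotopically trivial self-intersections, d(g(t), s_i) ≥ C for all i = 1,...,l and all t ∈ ℝ. In fact one may take, for each i, C_i = C_i' · cos(θ(s_i)/2), where C_i' > 0 satisfies d(s_i, s_j) > C_i' for all j ≠ i. -/

import Mathlib

open Metric Real Set

noncomputable section

/-- Distance between two angular coordinates in `ℝ / θℤ`. -/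
def circleDist (θ t₁ t₂ : ℝ) : ℝ := |(t₁ - t₂) - θ * round ((t₁ - t₂) / θ)|

/-- Distance on the standard Euclidean cone `C(v,θ)` of cone angle `θ`;
a point `(r,t)` has radial coordinate `r ≥ 0` and angular coordinate `t ∈ ℝ/θℤ`. -/
noncomputable def coneDist (θ : ℝ) (p q : ℝ × ℝ) : ℝ :=
  if Real.pi ≤ circleDist θ p.2 q.2 then p.1 + q.1
  else Real.sqrt (p.1 ^ 2 + q.1 ^ 2 - 2 * p.1 * q.1 * Real.cos (circleDist θ p.2 q.2))

/-- `x` has a neighborhood isometric to a disk in the Euclidean plane. -/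
def IsRegularPoint {S : Type*} [MetricSpace S] (x : S) : Prop :=
  ∃ ε > 0, ∃ f : S → EuclideanSpace ℝ (Fin 2),
    (∀ p ∈ ball x ε, ∀ q ∈ ball x ε, dist (f p) (f q) = dist p q) ∧
    f '' ball x ε = ball (f x) ε

/-- `x` has a neighborhood isometric to a neighborhood of the vertex of the
standard cone `C(v,θ)`. -/
def IsConicalPoint {S : Type*} [MetricSpace S] (θ : ℝ) (x : S) : Prop :=
  ∃ ε > 0, ∃ f : S → ℝ × ℝ,
    f x = (0, 0) ∧
    (∀ p ∈ ball x ε, 0 ≤ (f p).1 ∧ (f p).1 < ε) ∧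
    (∀ p ∈ ball x ε, ∀ q ∈ ball x ε, coneDist θ (f p) (f q) = dist p q) ∧
    (∀ r t : ℝ, 0 ≤ r → r < ε → ∃ p ∈ ball x ε, coneDist θ (f p) (r, t) = 0)

/-- The length of a path, as total variation. -/
noncomputable def pathLength {S : Type*} [MetricSpace S] {x y : S} (γ : Path x y) : ENNReal :=
  eVariationOn (fun t => γ t) Set.univ

/-- The metric is a length metric: the distance between two points is the infimum
of lengths of paths joining them. -/
def IsLengthSpace (S : Type*) [MetricSpace S] : Prop :=
  ∀ x y : S, edist x y = ⨅ γ : Path x y, pathLength γ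

/-- A Euclidean surface with conical singularities: a space with a length metric,
a finite set of conical points of prescribed positive angles, all other points
having Euclidean disk neighborhoods. -/
structure ESCS (S : Type*) [MetricSpace S] where
  conePts : Finset S
  angle : S → ℝ
  angle_pos : ∀ s ∈ conePts, 0 < angle s
  lengthMetric : IsLengthSpace S
  regular : ∀ x : S, x ∉ conePts → IsRegularPoint x
  conical : ∀ s ∈ conePts, IsConicalPoint (angle s) s

/-- All cone angles are `> 2π`. -/
def ESCS.BigAngles {S : Type*} [MetricSpace S] (E : ESCS S) : Prop :=
  ∀ s ∈ E.conePts, 2 * Real.pi < E.angle s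

/-- For closed orientable surfaces, genus `≥ 2` is equivalent to the fundamental
group being non-abelian. -/
def GenusAtLeastTwo (S : Type*) [TopologicalSpace S] : Prop :=
  ∃ (x : S) (a b : FundamentalGroup S x), a * b ≠ b * a

/-- A (globally) geodesic line: an isometric map `ℝ → X`. -/
def IsGeodesicLine {X : Type*} [MetricSpace X] (c : ℝ → X) : Prop :=
  ∀ s t : ℝ, dist (c s) (c t) = |s - t|

/-- A geodesic ray, recorded as a map `ℝ → X` which is isometric on `[0,∞)`
and constant on `(-∞,0]`. -/
def IsRay {X : Type*} [MetricSpace X] (r : ℝ → X) : Prop :=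
  (∀ s t : ℝ, 0 ≤ s → 0 ≤ t → dist (r s) (r t) = |s - t|) ∧ ∀ t ≤ 0, r t = r 0

abbrev RaySpace (X : Type*) [MetricSpace X] := {r : ℝ → X // IsRay r}

/-- Two geodesic rays are asymptotic when they are at bounded distance. -/
instance raySetoid (X : Type*) [MetricSpace X] : Setoid (RaySpace X) where
  r r₁ r₂ := ∃ C : ℝ, ∀ t : ℝ, 0 ≤ t → dist (r₁.1 t) (r₂.1 t) ≤ C
  iseqv := by
    constructor
    · intro r; exact ⟨0, fun t ht => by simp⟩
    · rintro r₁ r₂ ⟨C, hC⟩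
      exact ⟨C, fun t ht => by rw [dist_comm]; exact hC t ht⟩
    · rintro r₁ r₂ r₃ ⟨C₁, h₁⟩ ⟨C₂, h₂⟩
      exact ⟨C₁ + C₂, fun t ht =>
        (dist_triangle _ (r₂.1 t) _).trans (add_le_add (h₁ t ht) (h₂ t ht))⟩

/-- The visual boundary: asymptoty classes of geodesic rays, with the quotient
of the topology of (locally) uniform convergence of rays. -/
abbrev Boundary (X : Type*) [MetricSpace X] := Quotient (raySetoid X)

/-- The forward ray of a geodesic line. -/
def posRay {X : Type*} [MetricSpace X] (c : ℝ → X) (hc : IsGeodesicLine c) : RaySpace X :=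
  ⟨fun t => c (max t 0),
   ⟨fun s t hs ht => by
      show dist (c (max s 0)) (c (max t 0)) = |s - t|
      rw [max_eq_left hs, max_eq_left ht]; exact hc s t,
    fun t ht => by
      show c (max t 0) = c (max 0 0)
      rw [max_eq_right ht, max_self]⟩⟩

/-- The backward ray of a geodesic line. -/
def negRay {X : Type*} [MetricSpace X] (c : ℝ → X) (hc : IsGeodesicLine c) : RaySpace X :=
  ⟨fun t => c (-(max t 0)),
   ⟨fun s t hs ht => by
      show dist (c (-(max s 0))) (c (-(max t 0))) = |s - t|
      rw [max_eq_left hs, max_eq_left ht, hc, neg_sub_neg, abs_sub_comm],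
    fun t ht => by
      show c (-(max t 0)) = c (-(max 0 0))
      rw [max_eq_right ht, max_self]⟩⟩

/-- An isometry maps geodesic rays to geodesic rays. -/
def mapRay {X : Type*} [MetricSpace X] (φ : X ≃ᵢ X) (r : RaySpace X) : RaySpace X :=
  ⟨fun t => φ (r.1 t),
   ⟨fun s t hs ht => by rw [φ.isometry.dist_eq]; exact r.2.1 s t hs ht,
    fun t ht => by
      show φ (r.1 t) = φ (r.1 0)
      rw [r.2.2 t ht]⟩⟩

/-- The induced action of an isometry on the visual boundary. -/
def boundaryMap {X : Type*} [MetricSpace X] (φ : X ≃ᵢ X) : Boundary X → Boundary X :=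
  Quotient.map (mapRay φ) (by
    rintro r₁ r₂ ⟨C, hC⟩
    exact ⟨C, fun t ht => by
      show dist (φ (r₁.1 t)) (φ (r₂.1 t)) ≤ C
      rw [φ.isometry.dist_eq]; exact hC t ht⟩)

/-- The group of deck transformations of a covering `p : X → S`, acting by isometries. -/
def deckGroup {X S : Type*} [MetricSpace X] [MetricSpace S] (p : X → S) :
    Subgroup (X ≃ᵢ X) where
  carrier := {φ : X ≃ᵢ X | ∀ x, p (φ x) = p x}
  one_mem' := fun x => rfl
  mul_mem' := by
    intro a b ha hb x
    show p (a (b x)) = p x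
    rw [ha, hb]
  inv_mem' := by
    intro a ha x
    show p (a.symm x) = p x
    have h := ha (a.symm x)
    rw [a.apply_symm_apply] at h
    exact h.symm

/-- A hyperbolic (axial) isometry: it translates some geodesic line. -/
def IsAxial {X : Type*} [MetricSpace X] (φ : X ≃ᵢ X) : Prop :=
  ∃ c : ℝ → X, IsGeodesicLine c ∧ ∃ T : ℝ, 0 < T ∧ ∀ t : ℝ, φ (c t) = c (t + T)

/-- A local isometry between metric spaces. -/
def IsLocalIsometry {X S : Type*} [MetricSpace X] [MetricSpace S] (p : X → S) : Prop :=
  ∀ x : X, ∃ ε > 0, ∀ y ∈ ball x ε, ∀ z ∈ ball x ε, dist (p y) (p z) = dist y z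

/-- The universal covering of `S`: a simply connected space `X` with a covering
projection which is a local isometry. -/
structure UnivCover (X S : Type*) [MetricSpace X] [MetricSpace S] where
  p : X → S
  covering : IsCoveringMap p
  localIso : IsLocalIsometry p
  simplyConnected : SimplyConnectedSpace X

/-- `g` is a local isometric map near `t`. -/
def IsLocalGeodesicAt {S : Type*} [MetricSpace S] (g : ℝ → S) (t : ℝ) : Prop :=
  ∃ ε > 0, ∀ s u : ℝ, |s - t| < ε → |u - t| < ε → dist (g s) (g u) = |s - u|

/-- A geodesic in `S`: a local isometric map `ℝ → S`. -/
def IsLocalGeodesic {S : Type*} [MetricSpace S] (g : ℝ → S) : Prop :=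
  ∀ t : ℝ, IsLocalGeodesicAt g t

/-- A local isometric map on a subset of `ℝ` (geodesic ray for `A = [0,∞)`,
geodesic segment for `A = [a,b]`). -/
def IsLocalGeodesicOn {S : Type*} [MetricSpace S] (g : ℝ → S) (A : Set ℝ) : Prop :=
  ∀ t ∈ A, ∃ ε > 0, ∀ s ∈ A, ∀ u ∈ A, |s - t| < ε → |u - t| < ε → dist (g s) (g u) = |s - u|

/-- A closed geodesic: a periodic local isometric map `ℝ → S`. -/
def IsClosedGeodesic {S : Type*} [MetricSpace S] (g : ℝ → S) : Prop :=
  IsLocalGeodesic g ∧ ∃ T : ℝ, 0 < T ∧ Function.Periodic g T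

/-- Euclidean distance on `ℝ × ℝ`. -/
noncomputable def eudist (p q : ℝ × ℝ) : ℝ :=
  Real.sqrt ((p.1 - q.1) ^ 2 + (p.2 - q.2) ^ 2)

/-- `F` is an isometry from `D ⊂ ℝ²` (with the Euclidean metric) onto its image. -/
def IsStripChart {X : Type*} [MetricSpace X] (D : Set (ℝ × ℝ)) (F : ℝ × ℝ → X) : Prop :=
  ∀ p ∈ D, ∀ q ∈ D, dist (F p) (F q) = eudist p q

def stripDom (ε : ℝ) : Set (ℝ × ℝ) := Set.Icc 0 ε ×ˢ (Set.univ : Set ℝ)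
def halfStripDom (ε : ℝ) : Set (ℝ × ℝ) := Set.Icc 0 ε ×ˢ Set.Ici (0 : ℝ)
def rectDom (w l : ℝ) : Set (ℝ × ℝ) := Set.Icc 0 w ×ˢ Set.Icc 0 l

/-- A right-angle quadrangle of width `w` and length `l`: a subset isometric to
the Euclidean rectangle `[0,w] × [0,l]`. -/
def IsRectangle {X : Type*} [MetricSpace X] (w l : ℝ) (A : Set X) : Prop :=
  ∃ F : ℝ × ℝ → X, IsStripChart (rectDom w l) F ∧ F '' rectDom w l = A

/-- A geodesic ray `g` in `S` lies in a flat half strip of width `ε`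
(`g ∈ FHS(ε)`): some lift of `g` to the universal cover is one of the rays of a
flat half strip of width `ε`. -/
def RayInFHS {X S : Type*} [MetricSpace X] [MetricSpace S] (U : UnivCover X S)
    (ε : ℝ) (g : ℝ → S) : Prop :=
  ∃ (gt : ℝ → X) (F : ℝ × ℝ → X) (r : ℝ),
    (∀ t : ℝ, 0 ≤ t → U.p (gt t) = g t) ∧
    IsStripChart (halfStripDom ε) F ∧ r ∈ Set.Icc 0 ε ∧ ∀ t : ℝ, 0 ≤ t → gt t = F (r, t)

/-- A geodesic segment `g : [0,L] → S` lies in a flat half strip of width `ε`. -/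
def SegInFHS {X S : Type*} [MetricSpace X] [MetricSpace S] (U : UnivCover X S)
    (ε L : ℝ) (g : ℝ → S) : Prop :=
  ∃ (gt : ℝ → X) (F : ℝ × ℝ → X) (r : ℝ),
    (∀ t ∈ Set.Icc 0 L, U.p (gt t) = g t) ∧
    IsStripChart (halfStripDom ε) F ∧ r ∈ Set.Icc 0 ε ∧ ∀ t ∈ Set.Icc 0 L, gt t = F (r, t)

/-- A closed piece-wise geodesic: a periodic closed curve which is a local
geodesic except possibly where it meets the conical points of angle `< 2π`. -/
def IsClosedPiecewiseGeodesic {S : Type*} [MetricSpace S] (E : ESCS S) (γ : ℝ → S) : Prop :=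
  Continuous γ ∧ (∃ T : ℝ, 0 < T ∧ Function.Periodic γ T) ∧
  ∀ t : ℝ, ¬(γ t ∈ E.conePts ∧ E.angle (γ t) < 2 * Real.pi) → IsLocalGeodesicAt γ t

/-- A generalized saddle connection: a local geodesic segment whose endpoints are
conical points of angle `< 2π`, whose interior contains no such points. -/
def IsGenSaddleConnection {S : Type*} [MetricSpace S] (E : ESCS S) (σ : ℝ → S)
    (a b : ℝ) : Prop :=
  a < b ∧ IsLocalGeodesicOn σ (Set.Icc a b) ∧
  σ a ∈ E.conePts ∧ E.angle (σ a) < 2 * Real.pi ∧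
  σ b ∈ E.conePts ∧ E.angle (σ b) < 2 * Real.pi ∧
  ∀ t ∈ Set.Ioo a b, ¬(σ t ∈ E.conePts ∧ E.angle (σ t) < 2 * Real.pi)

/-- The loop obtained by restricting `g` to `[t₁,t₂]` when `g t₂ = g t₁`. -/
def loopOf {S : Type*} [MetricSpace S] {g : ℝ → S} (hg : Continuous g) (t₁ t₂ : ℝ)
    (h : g t₂ = g t₁) : Path (g t₁) (g t₁) where
  toFun := fun u => g (t₁ + (u : ℝ) * (t₂ - t₁))
  continuous_toFun := hg.comp (by fun_prop)
  source' := by simp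
  target' := by
    have h1 : t₁ + ((1 : unitInterval) : ℝ) * (t₂ - t₁) = t₂ := by norm_num
    show g (t₁ + ((1 : unitInterval) : ℝ) * (t₂ - t₁)) = g t₁
    rw [h1, h]

/-- `g` has a homotopically trivial self intersection. -/
def HasTrivialSelfIntersection {S : Type*} [MetricSpace S] {g : ℝ → S}
    (hg : Continuous g) : Prop :=
  ∃ t₁ t₂ : ℝ, t₁ < t₂ ∧ ∃ h : g t₂ = g t₁,
    (loopOf hg t₁ t₂ h).Homotopic (Path.refl (g t₁))

/-- The orbit `{t·g : t ∈ ℝ}` of a geodesic under the geodesic flow, inside the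
space `GS` of geodesics with the compact-open topology. -/
def translates {S : Type*} [MetricSpace S] (g : C(ℝ, S)) :
    Set {γ : C(ℝ, S) // IsLocalGeodesic ⇑γ} :=
  {β | ∃ t : ℝ, ∀ s : ℝ, β.1 s = g (t + s)}

/-- `F` restricts to an isometry from the disk of radius `δ` about `z` onto the ball of
radius `δ` about `F z`. -/
def IsDiskIso {S : Type*} [MetricSpace S] (F : ℂ → S) (z : ℂ) (δ : ℝ) : Prop :=
  (∀ a ∈ ball z δ, ∀ b ∈ ball z δ, dist (F a) (F b) = dist a b) ∧
    ∀ p ∈ ball (F z) δ, ∃ a ∈ ball z δ, F a = p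

/-- `F` is an isometry from a neighborhood of `z` onto a neighborhood of `F z`. -/
def LocIsoAt {S : Type*} [MetricSpace S] (F : ℂ → S) (z : ℂ) : Prop :=
  ∃ δ > 0, IsDiskIso F z δ

section PlaneGeometry

theorem Complex.dist_sq_eq (a b : ℂ) : dist a b ^ 2 = (a.re - b.re) ^ 2 + (a.im - b.im) ^ 2 := by
  rw [Complex.dist_eq, ← Complex.normSq_eq_norm_sq, Complex.normSq_apply]
  simp; ring

theorem Complex.re_sq_add_im_sq_of_norm_eq_one {u : ℂ} (hu : ‖u‖ = 1) :
    u.re ^ 2 + u.im ^ 2 = 1 := by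
  have := Complex.normSq_eq_norm_sq u
  rw [hu, Complex.normSq_apply] at this
  linarith

/-- A point of the plane is determined by its distances to three noncollinear points. -/
theorem eq_of_dist_eq_frame {c u a b : ℂ} {s : ℝ} (hs : s ≠ 0) (hu : ‖u‖ = 1)
    (h0 : dist c a = dist c b) (h1 : dist (c + s * u) a = dist (c + s * u) b)
    (h2 : dist (c + s * (Complex.I * u)) a = dist (c + s * (Complex.I * u)) b) : a = b := by
  have hu' := Complex.re_sq_add_im_sq_of_norm_eq_one hu
  have e0 := congrArg (· ^ 2) h0
  have e1 := congrArg (· ^ 2) h1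
  have e2 := congrArg (· ^ 2) h2
  simp only [Complex.dist_sq_eq] at e0 e1 e2
  simp at e1 e2
  have k1 : s * (u.re * (a.re - b.re) + u.im * (a.im - b.im)) = 0 := by linarith
  have k2 : s * (u.re * (a.im - b.im) - u.im * (a.re - b.re)) = 0 := by linarith
  have k1' := (mul_eq_zero.1 k1).resolve_left hs
  have k2' := (mul_eq_zero.1 k2).resolve_left hs
  apply Complex.ext
  · linear_combination u.re * k1' - u.im * k2' - (a.re - b.re) * hu'
  · linear_combination u.im * k1' + u.re * k2' - (a.im - b.im) * hu'

theorem eq_of_dist_eq_on_ball {z a b : ℂ} {δ : ℝ} (hδ : 0 < δ)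
    (h : ∀ p ∈ ball z δ, dist p a = dist p b) : a = b := by
  have hn : ‖((δ / 2 : ℝ) : ℂ)‖ = δ / 2 := by
    rw [Complex.norm_real, Real.norm_of_nonneg (by positivity)]
  refine eq_of_dist_eq_frame (c := z) (u := 1) (s := δ / 2) (by positivity) (by simp)
    (h _ (mem_ball_self hδ)) (h _ ?_) (h _ ?_)
  · rw [mem_ball, dist_eq_norm, add_sub_cancel_left, mul_one, hn]; linarith
  · rw [mem_ball, dist_eq_norm, add_sub_cancel_left, mul_one, norm_mul, hn]; simp; linarith

/-- The orientation preserving isometry `z ↦ w + u z` of the plane. -/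
def directIso (u w : ℂ) (hu : ‖u‖ = 1) : ℂ ≃ᵢ ℂ :=
  IsometryEquiv.mk' (fun z => w + u * z) (fun z => u⁻¹ * (z - w))
    (fun z => by
      have : u ≠ 0 := by rintro rfl; simp at hu
      field_simp; ring)
    (Isometry.of_dist_eq fun a b => by
      rw [dist_eq_norm, dist_eq_norm, add_sub_add_left_eq_sub, ← mul_sub, norm_mul, hu, one_mul])

/-- The orientation reversing isometry `z ↦ w + u z̄` of the plane. -/
def reversingIso (u w : ℂ) (hu : ‖u‖ = 1) : ℂ ≃ᵢ ℂ :=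
  Complex.conjLIE.toIsometryEquiv.trans (directIso u w hu)

@[simp] theorem directIso_apply (u w : ℂ) (hu : ‖u‖ = 1) (z : ℂ) :
    directIso u w hu z = w + u * z := rfl

@[simp] theorem reversingIso_apply (u w : ℂ) (hu : ‖u‖ = 1) (z : ℂ) :
    reversingIso u w hu z = w + u * (starRingEnd ℂ) z := rfl

/-- An isometric embedding of a disk in the plane is a rigid motion. -/
theorem exists_rigid_of_isometric_on_ball {k : ℂ → ℂ} {z : ℂ} {δ : ℝ} (hδ : 0 < δ)
    (hk : ∀ a ∈ ball z δ, ∀ b ∈ ball z δ, dist (k a) (k b) = dist a b) :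
    ∃ (A : ℂ ≃ᵢ ℂ) (u w : ℂ) (hu : ‖u‖ = 1), (A = directIso u w hu ∨ A = reversingIso u w hu) ∧
      ∀ a ∈ ball z δ, k a = A a := by
  set s : ℝ := δ / 2 with hs
  have hs0 : 0 < s := by positivity
  have hsn : ‖(s : ℂ)‖ = s := by rw [Complex.norm_real, Real.norm_of_nonneg hs0.le]
  have hsC : (s : ℂ) ≠ 0 := by exact_mod_cast hs0.ne'
  have m0 : z ∈ ball z δ := mem_ball_self hδ
  have m1 : z + s ∈ ball z δ := by
    rw [mem_ball, dist_eq_norm, add_sub_cancel_left, hsn]; linarith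
  have m2 : z + s * Complex.I ∈ ball z δ := by
    rw [mem_ball, dist_eq_norm, add_sub_cancel_left, norm_mul, hsn]; simp; linarith
  obtain ⟨u, hu⟩ : ∃ u, k (z + s) = k z + s * u :=
    ⟨(k (z + s) - k z) / s, by field_simp; ring⟩
  obtain ⟨v, hv⟩ : ∃ v, k (z + s * Complex.I) = k z + s * v :=
    ⟨(k (z + s * Complex.I) - k z) / s, by field_simp; ring⟩
  have hu1 : ‖u‖ = 1 := by
    have := hk _ m1 _ m0
    rw [hu, dist_eq_norm, dist_eq_norm, add_sub_cancel_left, add_sub_cancel_left, norm_mul,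
      hsn] at this
    exact mul_left_cancel₀ hs0.ne' (by linarith)
  have hv1 : ‖v‖ = 1 := by
    have := hk _ m2 _ m0
    rw [hv, dist_eq_norm, dist_eq_norm, add_sub_cancel_left, add_sub_cancel_left, norm_mul,
      norm_mul, hsn, Complex.norm_I] at this
    exact mul_left_cancel₀ hs0.ne' (by linarith)
  have hu' := Complex.re_sq_add_im_sq_of_norm_eq_one hu1
  have hv' := Complex.re_sq_add_im_sq_of_norm_eq_one hv1
  have horth : u.re * v.re + u.im * v.im = 0 := by
    have := congrArg (· ^ 2) (hk _ m1 _ m2)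
    rw [hu, hv] at this
    simp only [Complex.dist_sq_eq] at this
    simp at this
    have h2 : s ^ 2 * (u.re * v.re + u.im * v.im) = 0 := by
      linear_combination (-1 / 2) * this + s ^ 2 / 2 * hu' + s ^ 2 / 2 * hv'
    exact (mul_eq_zero.1 h2).resolve_left (by positivity)
  have hcases : v = Complex.I * u ∨ v = -(Complex.I * u) := by
    have hd : (u.re * v.im - u.im * v.re - 1) * (u.re * v.im - u.im * v.re + 1) = 0 := by
      linear_combination -(u.re * v.re + u.im * v.im) * horth + (v.re ^ 2 + v.im ^ 2) * hu' + hv'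
    rcases mul_eq_zero.1 hd with h | h
    · left
      apply Complex.ext <;> simp
      · linear_combination u.re * horth - u.im * h - v.re * hu'
      · linear_combination u.im * horth + u.re * h - v.im * hu'
    · right
      apply Complex.ext <;> simp
      · linear_combination u.re * horth - u.im * h - v.re * hu'
      · linear_combination u.im * horth + u.re * h - v.im * hu'
  have key : ∀ A : ℂ ≃ᵢ ℂ, A z = k z → A (z + s) = k (z + s) →
      A (z + s * Complex.I) = k (z + s * Complex.I) → ∀ a ∈ ball z δ, k a = A a := by
    intro A h0 h1 h2 a ha
    have d0 : dist (k z) (k a) = dist (k z) (A a) := by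
      rw [hk _ m0 _ ha, ← h0, A.dist_eq]
    have d1 : dist (k (z + s)) (k a) = dist (k (z + s)) (A a) := by
      rw [hk _ m1 _ ha, ← h1, A.dist_eq]
    have d2 : dist (k (z + s * Complex.I)) (k a) = dist (k (z + s * Complex.I)) (A a) := by
      rw [hk _ m2 _ ha, ← h2, A.dist_eq]
    rw [hu] at d1
    rw [hv] at d2
    rcases hcases with h | h
    · exact eq_of_dist_eq_frame hs0.ne' hu1 d0 d1 (by rw [← h]; exact d2)
    · have e : k z + s * v = k z + ((-s : ℝ) : ℂ) * (Complex.I * u) := by rw [h]; push_cast; ring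
      rw [e] at d2
      have hcases2 : ∀ a' b' : ℂ, dist (k z) a' = dist (k z) b' →
          dist (k z + s * v) a' = dist (k z + s * v) b' →
          dist (k z + s * (Complex.I * u)) a' = dist (k z + s * (Complex.I * u)) b' := by
        intro a' b' g0 g2
        rw [h] at g2
        have g0' := congrArg (· ^ 2) g0
        have g2' := congrArg (· ^ 2) g2
        simp only [Complex.dist_sq_eq] at g0' g2'
        rw [← sq_eq_sq₀ dist_nonneg dist_nonneg, Complex.dist_sq_eq, Complex.dist_sq_eq]
        simp at g2' ⊢
        linear_combination 2 * g0' - g2'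
      exact eq_of_dist_eq_frame hs0.ne' hu1 d0 d1 (hcases2 _ _ d0 (by rw [e]; exact d2))
  rcases hcases with h | h
  · refine ⟨_, u, k z - u * z, hu1, Or.inl rfl, key _ ?_ ?_ ?_⟩
    · simp
    · rw [hu, directIso_apply]; ring
    · rw [hv, directIso_apply, h]; ring
  · refine ⟨_, u, k z - u * (starRingEnd ℂ) z, hu1, Or.inr rfl, key _ ?_ ?_ ?_⟩
    · simp
    · rw [hu, reversingIso_apply, map_add, Complex.conj_ofReal]; ring
    · rw [hv, reversingIso_apply, map_add, map_mul, Complex.conj_ofReal, Complex.conj_I, h]; ring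

/-- An isometry of the plane fixing a disk pointwise is the identity. -/
theorem isometryEquiv_eq_self_of_eventually {A : ℂ ≃ᵢ ℂ} {y : ℂ}
    (h : ∀ᶠ a in nhds y, A a = a) (a : ℂ) : A a = a := by
  obtain ⟨δ, hδ, hA⟩ := Metric.eventually_nhds_iff_ball.1 h
  refine eq_of_dist_eq_on_ball (z := y) hδ fun p hp => ?_
  conv_lhs => rw [← hA p hp]
  exact A.dist_eq _ _

theorem eq_smul_of_dist_eq {p e : ℂ} {x h : ℝ} (hh : h ≠ 0) (he : ‖e‖ = 1) (h0 : ‖p‖ = |x|)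
    (h1 : dist p (h * e) = |x - h|) : p = x * e := by
  have he' := Complex.re_sq_add_im_sq_of_norm_eq_one he
  have e1 := congrArg (· ^ 2) h1
  have e0 := congrArg (· ^ 2) h0
  simp only [Complex.dist_sq_eq, sq_abs] at e1
  simp only [sq_abs, ← Complex.normSq_eq_norm_sq, Complex.normSq_apply] at e0
  simp at e1
  have k1 : h * (p.re * e.re + p.im * e.im - x) = 0 := by
    linear_combination (-1 / 2) * e1 + (1 / 2) * e0 + h ^ 2 / 2 * he'
  have k2 := (mul_eq_zero.1 k1).resolve_left hh
  have k3 : (p.im * e.re - p.re * e.im) ^ 2 = 0 := by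
    linear_combination (p.re ^ 2 + p.im ^ 2) * he' + e0 -
      (p.re * e.re + p.im * e.im + x) * k2
  have k4 := pow_eq_zero_iff (two_ne_zero) |>.1 k3
  apply Complex.ext <;> simp
  · linear_combination e.re * k2 - e.im * k4 - p.re * he'
  · linear_combination e.im * k2 + e.re * k4 - p.im * he'

end PlaneGeometry

section LocalIsometries

variable {S : Type*} [MetricSpace S]

theorem IsDiskIso.mono {F : ℂ → S} {z w : ℂ} {δ ρ : ℝ} (h : IsDiskIso F z δ) (hρ : 0 < ρ)
    (hsub : dist w z + ρ ≤ δ) : IsDiskIso F w ρ := by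
  have hb : ball w ρ ⊆ ball z δ := ball_subset_ball' (by linarith)
  have hwz : w ∈ ball z δ := hb (mem_ball_self hρ)
  have hz : z ∈ ball z δ := mem_ball_self (by linarith [dist_nonneg (x := w) (y := z)])
  refine ⟨fun a ha b hb' => h.1 a (hb ha) b (hb hb'), fun p hp => ?_⟩
  have hp' : p ∈ ball (F z) δ := by
    have h1 := dist_triangle p (F w) (F z)
    rw [h.1 w hwz z hz] at h1
    rw [mem_ball] at hp ⊢
    linarith
  obtain ⟨a, ha, rfl⟩ := h.2 p hp'
  refine ⟨a, ?_, rfl⟩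
  rw [mem_ball, ← h.1 a ha w hwz]
  exact hp

theorem IsDiskIso.congr {F G : ℂ → S} {z : ℂ} {δ : ℝ} (hδ : 0 < δ) (h : IsDiskIso F z δ)
    (hFG : ∀ a ∈ ball z δ, F a = G a) : IsDiskIso G z δ := by
  refine ⟨fun a ha b hb => by rw [← hFG a ha, ← hFG b hb]; exact h.1 a ha b hb, fun p hp => ?_⟩
  rw [← hFG z (mem_ball_self hδ)] at hp
  obtain ⟨a, ha, hap⟩ := h.2 p hp
  exact ⟨a, ha, by rw [← hFG a ha, hap]⟩

theorem IsDiskIso.locIsoAt {F : ℂ → S} {z w : ℂ} {δ : ℝ} (h : IsDiskIso F z δ)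
    (hw : w ∈ ball z δ) : LocIsoAt F w := by
  rw [mem_ball] at hw
  exact ⟨δ - dist w z, by linarith, h.mono (by linarith) (by linarith)⟩

theorem LocIsoAt.exists_le {F : ℂ → S} {z : ℂ} (h : LocIsoAt F z) {ε : ℝ} (hε : 0 < ε) :
    ∃ δ > 0, δ ≤ ε ∧ IsDiskIso F z δ := by
  obtain ⟨δ, hδ, h⟩ := h
  exact ⟨min δ ε, lt_min hδ hε, min_le_right _ _, h.mono (lt_min hδ hε) (by simp)⟩

theorem LocIsoAt.congr {F G : ℂ → S} {z : ℂ} (h : LocIsoAt F z) (hFG : F =ᶠ[nhds z] G) :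
    LocIsoAt G z := by
  obtain ⟨ε, hε, hFG⟩ := Metric.eventually_nhds_iff_ball.1 hFG
  obtain ⟨δ, hδ, hle, h⟩ := h.exists_le hε
  exact ⟨δ, hδ, h.congr hδ fun a ha => hFG a (ball_subset_ball hle ha)⟩

theorem IsDiskIso.comp_isometry {F : ℂ → S} {z : ℂ} {δ : ℝ} (A : ℂ ≃ᵢ ℂ)
    (h : IsDiskIso F (A z) δ) : IsDiskIso (fun x => F (A x)) z δ := by
  have hA : ∀ a, a ∈ ball z δ → A a ∈ ball (A z) δ := fun a ha => by
    rw [mem_ball, A.dist_eq]; exact ha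
  refine ⟨fun a ha b hb => ?_, fun p hp => ?_⟩
  · rw [h.1 _ (hA a ha) _ (hA b hb), A.dist_eq]
  · obtain ⟨a, ha, rfl⟩ := h.2 p hp
    refine ⟨A.symm a, ?_, by simp⟩
    rw [mem_ball, ← A.dist_eq]
    simpa using ha

theorem LocIsoAt.comp_isometry {F : ℂ → S} {z : ℂ} (A : ℂ ≃ᵢ ℂ) (h : LocIsoAt F (A z)) :
    LocIsoAt (fun x => F (A x)) z :=
  let ⟨δ, hδ, h⟩ := h
  ⟨δ, hδ, h.comp_isometry⟩

theorem LocIsoAt.continuousAt {F : ℂ → S} {z : ℂ} (h : LocIsoAt F z) : ContinuousAt F z := by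
  obtain ⟨δ, hδ, h⟩ := h
  rw [Metric.continuousAt_iff]
  intro ε hε
  refine ⟨min δ ε, lt_min hδ hε, fun x hx => ?_⟩
  rw [h.1 x (lt_of_lt_of_le hx (min_le_left _ _)) z (mem_ball_self hδ)]
  exact lt_of_lt_of_le hx (min_le_right _ _)

/-- Local isometries are locally injective. -/
theorem LocIsoAt.eventually_eq {X : Type*} [TopologicalSpace X] {F : ℂ → S} {z : ℂ}
    (h : LocIsoAt F z) {k l : X → ℂ} {x : X} (hk : ContinuousAt k x) (hl : ContinuousAt l x)
    (hkx : k x = z) (hlx : l x = z) : ∀ᶠ y in nhds x, F (k y) = F (l y) → k y = l y := by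
  obtain ⟨δ, hδ, h⟩ := h
  have h1 : ∀ᶠ y in nhds x, k y ∈ ball z δ :=
    hk.eventually (by rw [hkx]; exact ball_mem_nhds _ hδ)
  have h2 : ∀ᶠ y in nhds x, l y ∈ ball z δ :=
    hl.eventually (by rw [hlx]; exact ball_mem_nhds _ hδ)
  filter_upwards [h1, h2] with y h1 h2 he
  have := h.1 _ h1 _ h2
  rw [he, dist_self] at this
  exact dist_eq_zero.1 this.symm

/-- Two local isometries with a common value differ locally by a rigid motion. -/
theorem LocIsoAt.exists_transition {F G : ℂ → S} {z w : ℂ} (hF : LocIsoAt F z)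
    (hG : LocIsoAt G w) (hFG : F z = G w) :
    ∃ (A : ℂ ≃ᵢ ℂ) (u v : ℂ) (hu : ‖u‖ = 1), (A = directIso u v hu ∨ A = reversingIso u v hu) ∧
      A z = w ∧ F =ᶠ[nhds z] fun x => G (A x) := by
  obtain ⟨ε, hε, hG⟩ := hG
  obtain ⟨δ, hδ, hle, hF⟩ := hF.exists_le hε
  have hG := hG.mono (w := w) hδ (by simpa using hle)
  have hex : ∀ a, ∃ b, a ∈ ball z δ → b ∈ ball w δ ∧ G b = F a := by
    intro a
    by_cases ha : a ∈ ball z δ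
    · have : F a ∈ ball (G w) δ := by
        rw [mem_ball, ← hFG, hF.1 a ha z (mem_ball_self hδ)]; exact ha
      obtain ⟨b, hb, hb'⟩ := hG.2 _ this
      exact ⟨b, fun _ => ⟨hb, hb'⟩⟩
    · exact ⟨0, fun h => absurd h ha⟩
  choose k hk using hex
  have hiso : ∀ a ∈ ball z δ, ∀ b ∈ ball z δ, dist (k a) (k b) = dist a b := by
    intro a ha b hb
    rw [← hG.1 _ (hk a ha).1 _ (hk b hb).1, (hk a ha).2, (hk b hb).2, hF.1 a ha b hb]
  obtain ⟨A, u, v, hu, hA, hkA⟩ := exists_rigid_of_isometric_on_ball hδ hiso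
  refine ⟨A, u, v, hu, hA, ?_, ?_⟩
  · have hz := mem_ball_self (x := z) hδ
    rw [← hkA z hz]
    have := hG.1 _ (hk z hz).1 w (mem_ball_self hδ)
    rw [(hk z hz).2, hFG, dist_self] at this
    exact dist_eq_zero.1 this.symm
  · filter_upwards [ball_mem_nhds z hδ] with a ha
    rw [← hkA a ha, (hk a ha).2]

/-- Unique continuation for local isometries. -/
theorem LocIsoAt.eqOn {F G : ℂ → S} {W : Set ℂ} (hW : IsPreconnected W)
    (hF : ∀ z ∈ W, LocIsoAt F z) (hG : ∀ z ∈ W, LocIsoAt G z) {x₀ : ℂ} (hx₀ : x₀ ∈ W)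
    (h₀ : F =ᶠ[nhds x₀] G) : ∀ z ∈ W, F =ᶠ[nhds z] G := by
  have hopen : IsOpen {x | F =ᶠ[nhds x] G} := isOpen_setOfPred_eventually_nhds
  refine hW.subset_of_closure_inter_subset hopen ⟨x₀, hx₀, h₀⟩ ?_
  rintro x ⟨hxc, hxW⟩
  have hfreq : ∃ᶠ y in nhds x, F =ᶠ[nhds y] G := mem_closure_iff_frequently.1 hxc
  have hx : F x = G x := by
    by_contra hne
    have := ((hF x hxW).continuousAt.prodMk (hG x hxW).continuousAt).eventually
      ((isOpen_ne_fun continuous_fst continuous_snd).mem_nhds hne :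
        {p : S × S | p.1 ≠ p.2} ∈ nhds (F x, G x))
    obtain ⟨y, h1, h2⟩ := (hfreq.and_eventually this).exists
    exact h2 h1.self_of_nhds
  obtain ⟨A, -, -, -, -, hAx, hA⟩ := (hF x hxW).exists_transition (hG x hxW) hx
  have hinj := (hG x hxW).eventually_eq (k := A) (l := id) A.continuous.continuousAt
    continuousAt_id hAx rfl
  obtain ⟨y, h1, h2, h3⟩ := (hfreq.and_eventually
    (hA.eventually_nhds.and hinj.eventually_nhds)).exists
  have hid : ∀ a, A a = a := isometryEquiv_eq_self_of_eventually (y := y) <| by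
    filter_upwards [h1, h2, h3] with a h1 h2 h3
    exact h3 (by rw [← h2, h1]; rfl)
  show F =ᶠ[nhds x] G
  filter_upwards [hA] with a ha
  rw [ha, hid]

/-- A local isometry on a convex set is distance nonincreasing. -/
theorem LocIsoAt.dist_le {F : ℂ → S} {W : Set ℂ} (hW : Convex ℝ W)
    (hF : ∀ z ∈ W, LocIsoAt F z) {a b : ℂ} (ha : a ∈ W) (hb : b ∈ W) :
    dist (F a) (F b) ≤ dist a b := by
  set l : ℝ → ℂ := fun u => AffineMap.lineMap a b u with hl
  have hlc : Continuous l := AffineMap.lineMap_continuous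
  have hlW : ∀ u ∈ Icc (0 : ℝ) 1, l u ∈ W := fun u hu =>
    hW.lineMap_mem ha hb hu
  have hld : ∀ u v, dist (l u) (l v) = |u - v| * dist a b := fun u v => by
    simp [hl, dist_lineMap_lineMap, Real.dist_eq]
  have hcont : ContinuousOn (fun u => F (l u)) (Icc 0 1) := fun u hu =>
    ((hF _ (hlW u hu)).continuousAt.comp hlc.continuousAt).continuousWithinAt
  have hclosed : IsClosed ({u | dist (F a) (F (l u)) ≤ u * dist a b} ∩ Icc (0 : ℝ) 1) := by
    rw [inter_comm]
    exact (isClosed_Icc.isClosed_le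
      (continuous_dist.comp_continuousOn (continuousOn_const.prodMk hcont))
      (by fun_prop : ContinuousOn (fun u : ℝ => u * dist a b) (Icc 0 1)))
  have h1 : (1 : ℝ) ∈ {u | dist (F a) (F (l u)) ≤ u * dist a b} := by
    refine hclosed.Icc_subset_of_forall_exists_gt (by simp [hl]) ?_ (right_mem_Icc.2 zero_le_one)
    rintro u ⟨hu, hu0, hu1⟩ y hy
    obtain ⟨δ, hδ, hFu⟩ := hF _ (hlW u ⟨hu0, hu1.le⟩)
    have hev : ∀ᶠ v in nhds u, l v ∈ ball (l u) δ := hlc.continuousAt.eventually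
      (ball_mem_nhds _ hδ)
    have hev2 : ∀ᶠ v in nhdsWithin u (Ioi u), l v ∈ ball (l u) δ ∧ v ∈ Ioc u y :=
      (hev.filter_mono nhdsWithin_le_nhds).and (Ioc_mem_nhdsGT hy)
    obtain ⟨v, hv, hvy⟩ := hev2.exists
    refine ⟨v, ?_, hvy⟩
    have h2 := hFu.1 _ (mem_ball_self hδ) _ hv
    rw [hld, abs_sub_comm, abs_of_pos (sub_pos.2 hvy.1)] at h2
    have h3 := dist_triangle (F a) (F (l u)) (F (l v))
    simp only [mem_ofPred_eq] at hu ⊢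
    rw [h2] at h3
    nlinarith
  simpa [hl] using h1

theorem IsLocalGeodesicAt.continuousAt {c : ℝ → S} {x : ℝ} (h : IsLocalGeodesicAt c x) :
    ContinuousAt c x := by
  obtain ⟨δ, hδ, h⟩ := h
  rw [Metric.continuousAt_iff]
  intro ε hε
  refine ⟨min δ ε, lt_min hδ hε, fun y hy => ?_⟩
  rw [Real.dist_eq] at hy
  rw [h y x (lt_of_lt_of_le hy (min_le_left _ _)) (by simpa using hδ)]
  exact lt_of_lt_of_le hy (min_le_right _ _)

/-- In a flat chart, a local geodesic is a straight line of unit speed. -/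
theorem LocIsoAt.exists_line {F : ℂ → S} {z : ℂ} (hF : LocIsoAt F z) {c : ℝ → S} {x₀ : ℝ}
    (hc : IsLocalGeodesicAt c x₀) (h : F z = c x₀) :
    ∃ e : ℂ, ‖e‖ = 1 ∧ ∀ᶠ x in nhds x₀, c x = F (z + ((x - x₀ : ℝ) : ℂ) * e) := by
  obtain ⟨ε, hε, hc⟩ := hc
  obtain ⟨δ, hδ, hle, hF⟩ := hF.exists_le hε
  have hex : ∀ x, ∃ b, |x - x₀| < δ → b ∈ ball z δ ∧ F b = c x := by
    intro x
    by_cases hx : |x - x₀| < δ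
    · have : c x ∈ ball (F z) δ := by
        rw [mem_ball, h, hc x x₀ (hx.trans_le hle) (by simpa using hε)]; exact hx
      obtain ⟨b, hb, hb'⟩ := hF.2 _ this
      exact ⟨b, fun _ => ⟨hb, hb'⟩⟩
    · exact ⟨0, fun h => absurd h hx⟩
  choose k hk using hex
  have hiso : ∀ x y, |x - x₀| < δ → |y - x₀| < δ → dist (k x) (k y) = |x - y| := by
    intro x y hx hy
    rw [← hF.1 _ (hk x hx).1 _ (hk y hy).1, (hk x hx).2, (hk y hy).2,
      hc x y (hx.trans_le hle) (hy.trans_le hle)]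
  have hx0 : |x₀ - x₀| < δ := by simpa using hδ
  have hk0 : k x₀ = z := by
    have := hF.1 _ (hk x₀ hx0).1 z (mem_ball_self hδ)
    rw [(hk x₀ hx0).2, h, dist_self] at this
    exact dist_eq_zero.1 this.symm
  set s := δ / 2 with hs
  have hs0 : 0 < s := by positivity
  have hx1 : |x₀ + s - x₀| < δ := by rw [add_sub_cancel_left, abs_of_pos hs0]; linarith
  obtain ⟨e, he⟩ : ∃ e, k (x₀ + s) = z + s * e := by
    have : (s : ℂ) ≠ 0 := by exact_mod_cast hs0.ne'
    exact ⟨(k (x₀ + s) - z) / s, by field_simp; ring⟩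
  have he1 : ‖e‖ = 1 := by
    have := hiso _ _ hx1 hx0
    rw [he, hk0, dist_eq_norm, add_sub_cancel_left, norm_mul, Complex.norm_real,
      Real.norm_of_nonneg hs0.le, add_sub_cancel_left, abs_of_pos hs0] at this
    exact mul_left_cancel₀ hs0.ne' (by linarith)
  refine ⟨e, he1, Metric.eventually_nhds_iff_ball.2 ⟨δ, hδ, fun x hx => ?_⟩⟩
  rw [mem_ball, Real.dist_eq] at hx
  have h3 : k x - z = ((x - x₀ : ℝ) : ℂ) * e := by
    refine eq_smul_of_dist_eq hs0.ne' he1 ?_ ?_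
    · rw [← dist_eq_norm, ← hiso x x₀ hx hx0, hk0]
    · have := hiso x _ hx hx1
      rw [he] at this
      rw [show x - x₀ - s = x - (x₀ + s) by ring, ← this, dist_eq_norm, dist_eq_norm]
      congr 1; ring
  rw [← h3, ← (hk x hx).2]
  congr 1; ring

/-- Unique continuation for geodesics, in the image of a flat convex set. -/
theorem IsLocalGeodesicAt.eq_line {c : ℝ → S} {I : Set ℝ} (hI : Convex ℝ I)
    (hc : ∀ x ∈ I, IsLocalGeodesicAt c x) {F : ℂ → S} {W : Set ℂ} (hW : Convex ℝ W)
    (hF : ∀ z ∈ W, LocIsoAt F z) {z e : ℂ} {x₁ x₀ : ℝ} (hx₀ : x₀ ∈ I)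
    (hzW : z + ((x₀ - x₁ : ℝ) : ℂ) * e ∈ W)
    (h₀ : ∀ᶠ x in nhds x₀, c x = F (z + ((x - x₁ : ℝ) : ℂ) * e)) {x : ℝ} (hx : x ∈ I)
    (hxW : z + ((x - x₁ : ℝ) : ℂ) * e ∈ W) : c x = F (z + ((x - x₁ : ℝ) : ℂ) * e) := by
  set l : ℝ → ℂ := fun x => z + ((x - x₁ : ℝ) : ℂ) * e with hl
  have hlc : Continuous l := by fun_prop
  have hJ : Convex ℝ (I ∩ l ⁻¹' W) := by
    refine hI.inter fun a ha b hb s t hs ht hst => ?_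
    have : l (s • a + t • b) = s • l a + t • l b := by
      have hst' : (s : ℂ) + t = 1 := by exact_mod_cast hst
      simp only [hl, smul_eq_mul, Complex.real_smul]
      push_cast
      linear_combination (-z + x₁ * e) * hst'
    rw [mem_preimage, this]
    exact hW ha hb hs ht hst
  have key : I ∩ l ⁻¹' W ⊆ {x | ∀ᶠ y in nhds x, c y = F (l y)} := by
    refine hJ.isPreconnected.subset_of_closure_inter_subset isOpen_setOfPred_eventually_nhds
      ⟨x₀, ⟨hx₀, hzW⟩, h₀⟩ ?_
    rintro y ⟨hyc, hyI, hyW⟩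
    have hfreq : ∃ᶠ x in nhds y, ∀ᶠ y in nhds x, c y = F (l y) := mem_closure_iff_frequently.1 hyc
    have hFy := hF _ hyW
    have hcy := hc y hyI
    have hy : F (l y) = c y := by
      by_contra hne
      have hFl : ContinuousAt (fun x => F (l x)) y :=
        ContinuousAt.comp (f := l) (g := F) hFy.continuousAt hlc.continuousAt
      have := (hFl.prodMk hcy.continuousAt).eventually
        ((isOpen_ne_fun continuous_fst continuous_snd).mem_nhds hne :
          {p : S × S | p.1 ≠ p.2} ∈ nhds (F (l y), c y))
      obtain ⟨x, h1, h2⟩ := (hfreq.and_eventually this).exists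
      exact h2 h1.self_of_nhds.symm
    obtain ⟨e', he', hline⟩ := hFy.exists_line hcy hy
    have hinj := hFy.eventually_eq (k := l) (l := fun x => l y + ((x - y : ℝ) : ℂ) * e')
      (x := y) hlc.continuousAt (by fun_prop) rfl (by simp)
    obtain ⟨x, h1, h2, h3⟩ := (hfreq.and_eventually
      (hline.eventually_nhds.and hinj.eventually_nhds)).exists
    obtain ⟨w, ⟨h1, h2, h3⟩, hwy⟩ : ∃ w, (c w = F (l w) ∧
        c w = F (l y + ((w - y : ℝ) : ℂ) * e') ∧ (F (l w) = F (l y + ((w - y : ℝ) : ℂ) * e') →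
          l w = l y + ((w - y : ℝ) : ℂ) * e')) ∧ w ≠ y := by
      have h4 := (h1.and (h2.and h3))
      have h5 : ∃ᶠ w in nhds x, w ≠ y := by
        have : Dense ({y}ᶜ : Set ℝ) := dense_compl_singleton y
        exact mem_closure_iff_frequently.1 (this x)
      obtain ⟨w, hw1, hw2⟩ := (h5.and_eventually h4).exists
      exact ⟨w, hw2, hw1⟩
    have h4 := h3 (by rw [← h1, h2])
    have hee : e = e' := by
      have hne : ((w - y : ℝ) : ℂ) ≠ 0 := by exact_mod_cast sub_ne_zero.2 hwy
      refine mul_left_cancel₀ hne ?_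
      simp only [hl] at h4
      push_cast at h4 ⊢
      linear_combination h4
    show ∀ᶠ x in nhds y, c x = F (l x)
    filter_upwards [hline] with x hx
    rw [hx, ← hee]
    simp only [hl]
    congr 1
    push_cast
    ring
  exact (key ⟨hx, hxW⟩).self_of_nhds

end LocalIsometries

section PolarCharts

theorem circleDist_le {θ : ℝ} (hθ : 0 < θ) (a b : ℝ) : circleDist θ a b ≤ θ / 2 := by
  have h := abs_sub_round ((a - b) / θ)
  have h2 : a - b - θ * round ((a - b) / θ) = θ * ((a - b) / θ - round ((a - b) / θ)) := by
    field_simp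
  rw [circleDist, h2, abs_mul, abs_of_pos hθ]
  nlinarith

theorem circleDist_nonneg (θ a b : ℝ) : 0 ≤ circleDist θ a b := abs_nonneg _

theorem circleDist_eq_abs {θ a b : ℝ} (hθ : 0 < θ) (h : |a - b| ≤ θ / 2) :
    circleDist θ a b = |a - b| := by
  refine le_antisymm ?_ ?_
  · rw [circleDist]
    have h := round_le ((a - b) / θ) 0
    have e1 : a - b - θ * round ((a - b) / θ) = θ * ((a - b) / θ - round ((a - b) / θ)) := by
      field_simp
    rw [e1, abs_mul, abs_of_pos hθ]
    calc _ ≤ θ * |(a - b) / θ - (0 : ℤ)| := mul_le_mul_of_nonneg_left h hθ.le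
      _ = |a - b| := by
        rw [Int.cast_zero, sub_zero, abs_div, abs_of_pos hθ]
        field_simp
  · rw [circleDist]
    obtain hk | hk := eq_or_ne (round ((a - b) / θ)) 0
    · simp [hk]
    · have h1 : (1 : ℝ) ≤ |(round ((a - b) / θ) : ℝ)| := by exact_mod_cast Int.one_le_abs hk
      have h2 := abs_sub_abs_le_abs_sub (θ * (round ((a - b) / θ) : ℝ)) (a - b)
      rw [abs_mul, abs_of_pos hθ, abs_sub_comm _ (a - b)] at h2
      nlinarith

theorem circleDist_add_int_mul_left {θ : ℝ} (hθ : 0 < θ) (a b : ℝ) (k : ℤ) :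
    circleDist θ (a + θ * k) b = circleDist θ a b := by
  have h : (a + θ * k - b) / θ = (a - b) / θ + k := by field_simp; ring
  rw [circleDist, h, round_add_intCast, circleDist]
  congr 1
  push_cast
  ring

theorem circleDist_comm {θ : ℝ} (hθ : 0 < θ) (a b : ℝ) : circleDist θ a b = circleDist θ b a := by
  have key : ∀ a b, circleDist θ a b ≤ circleDist θ b a := fun a b => by
    have h := round_le ((a - b) / θ) (-round ((b - a) / θ))
    have e1 : a - b - θ * round ((a - b) / θ) = θ * ((a - b) / θ - round ((a - b) / θ)) := by
      field_simp
    have e2 : b - a - θ * round ((b - a) / θ) =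
        -(θ * ((a - b) / θ - (-round ((b - a) / θ) : ℤ))) := by
      push_cast; field_simp; ring
    rw [circleDist, circleDist, e1, e2, abs_neg, abs_mul, abs_mul]
    exact mul_le_mul_of_nonneg_left h (abs_nonneg _)
  exact le_antisymm (key _ _) (key _ _)

theorem exists_eq_add_of_circleDist_eq_zero {θ a b : ℝ} (h : circleDist θ a b = 0) :
    ∃ k : ℤ, a = b + θ * k :=
  ⟨round ((a - b) / θ), by rw [circleDist, abs_eq_zero] at h; linarith⟩

theorem coneDist_eq_sqrt {θ : ℝ} (hθ : 0 < θ) (hθ' : θ < π) (p q : ℝ × ℝ) :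
    coneDist θ p q = √(p.1 ^ 2 + q.1 ^ 2 - 2 * p.1 * q.1 * Real.cos (circleDist θ p.2 q.2)) := by
  rw [coneDist, if_neg]
  linarith [circleDist_le hθ p.2 q.2]

theorem coneDist_eq_dist {θ : ℝ} (hθ : 0 < θ) (hθ' : θ < π) {r t r' t' : ℝ}
    (h : |t - t'| ≤ θ / 2) : coneDist θ (r, t) (r', t') =
      dist ((r : ℂ) * Complex.exp (t * Complex.I)) ((r' : ℂ) * Complex.exp (t' * Complex.I)) := by
  rw [coneDist_eq_sqrt hθ hθ', circleDist_eq_abs hθ h, Real.cos_abs, Real.sqrt_eq_iff_mul_self_eq,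
    ← sq, Complex.dist_sq_eq]
  · simp [Complex.exp_ofReal_mul_I_re, Complex.exp_ofReal_mul_I_im, Real.cos_sub]
    nlinarith [Real.sin_sq_add_cos_sq t, Real.sin_sq_add_cos_sq t']
  · nlinarith [Real.neg_one_le_cos (t - t'), Real.cos_le_one (t - t'), sq_nonneg (r - r'),
      sq_nonneg (r + r')]
  · positivity

theorem coneDist_comm {θ : ℝ} (hθ : 0 < θ) (hθ' : θ < π) (p q : ℝ × ℝ) :
    coneDist θ p q = coneDist θ q p := by
  rw [coneDist_eq_sqrt hθ hθ', coneDist_eq_sqrt hθ hθ', circleDist_comm hθ]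
  congr 1
  ring

theorem coneDist_self {θ : ℝ} (hθ : 0 < θ) (hθ' : θ < π) (p : ℝ × ℝ) : coneDist θ p p = 0 := by
  obtain ⟨r, t⟩ := p
  rw [coneDist_eq_dist hθ hθ' (by rw [sub_self, abs_zero]; positivity), dist_self]

theorem coneDist_add_right {θ : ℝ} (hθ : 0 < θ) (hθ' : θ < π) (p : ℝ × ℝ) (r t : ℝ) (k : ℤ) :
    coneDist θ (r, t + θ * k) p = coneDist θ (r, t) p := by
  simp only [coneDist_eq_sqrt hθ hθ', circleDist_add_int_mul_left hθ]

theorem coneDist_zero_right {θ : ℝ} (hθ : 0 < θ) (hθ' : θ < π) {r : ℝ} (hr : 0 ≤ r) (t t' : ℝ) :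
    coneDist θ (r, t) (0, t') = r := by
  simp [coneDist_eq_sqrt hθ hθ', Real.sqrt_sq hr]

theorem coneDist_congr_of_eq_zero {θ : ℝ} (hθ : 0 < θ) (hθ' : θ < π) {p q : ℝ × ℝ} (hp : 0 ≤ p.1)
    (hq : 0 ≤ q.1) (h : coneDist θ p q = 0) (x : ℝ × ℝ) : coneDist θ p x = coneDist θ q x := by
  obtain ⟨r, t⟩ := p
  obtain ⟨r', t'⟩ := q
  have hc := Real.cos_le_one (circleDist θ t t')
  rw [coneDist_eq_sqrt hθ hθ'] at h
  simp only at hp hq h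
  have hrr := mul_nonneg hp hq
  rw [Real.sqrt_eq_zero (by nlinarith [sq_nonneg (r - r')])] at h
  have h1 : r = r' := by nlinarith [sq_nonneg (r - r')]
  subst h1
  have h2 : r ^ 2 * (1 - Real.cos (circleDist θ t t')) = 0 := by linarith
  rcases mul_eq_zero.1 h2 with h2 | h2
  · have : r = 0 := by simpa using h2
    simp [coneDist_eq_sqrt hθ hθ', this]
  · have h3 : circleDist θ t t' = 0 := by
      have h4 := circleDist_le hθ t t'
      have h5 := circleDist_nonneg θ t t'
      rw [← Real.cos_eq_one_iff_of_lt_of_lt (by linarith) (by linarith)]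
      linarith
    obtain ⟨k, rfl⟩ := exists_eq_add_of_circleDist_eq_zero h3
    rw [coneDist_add_right hθ hθ']

/-- `φ` parametrizes the ball `ball s ε` isometrically by polar coordinates of the standard cone
of angle `θ`. -/
structure IsPolarChart {S : Type*} [MetricSpace S] (θ : ℝ) (s : S) (ε : ℝ) (φ : ℝ → ℝ → S) :
    Prop where
  pos : 0 < ε
  zero : ∀ t, φ 0 t = s
  dist_eq : ∀ r t r' t', 0 ≤ r → r < ε → 0 ≤ r' → r' < ε →
    dist (φ r t) (φ r' t') = coneDist θ (r, t) (r', t')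
  surj : ∀ p ∈ ball s ε, ∃ r t, 0 ≤ r ∧ r < ε ∧ φ r t = p

variable {S : Type*} [MetricSpace S] {θ : ℝ} {s : S} {ε : ℝ} {φ : ℝ → ℝ → S}

theorem IsConicalPoint.exists_isPolarChart (hθ : 0 < θ) (hθ' : θ < π) (h : IsConicalPoint θ s) :
    ∃ ε φ, IsPolarChart θ s ε φ := by
  obtain ⟨ε, hε, f, hfs, hf, hd, hsurj⟩ := h
  have hex : ∀ r t : ℝ, ∃ p, 0 ≤ r → r < ε → p ∈ ball s ε ∧ coneDist θ (f p) (r, t) = 0 := by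
    intro r t
    by_cases hr : 0 ≤ r ∧ r < ε
    · obtain ⟨p, hp, hp'⟩ := hsurj r t hr.1 hr.2
      exact ⟨p, fun _ _ => ⟨hp, hp'⟩⟩
    · exact ⟨s, fun h1 h2 => absurd ⟨h1, h2⟩ hr⟩
  choose φ hφ using hex
  have hdist : ∀ p ∈ ball s ε, ∀ r t, 0 ≤ r → r < ε → dist (φ r t) p = coneDist θ (r, t) (f p) := by
    intro p hp r t h1 h2
    obtain ⟨hb, h0⟩ := hφ r t h1 h2
    rw [← hd _ hb _ hp]
    exact coneDist_congr_of_eq_zero hθ hθ' (hf _ hb).1 h1 h0 _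
  refine ⟨ε, φ, hε, fun t => ?_, fun r t r' t' h1 h2 h3 h4 => ?_, fun p hp => ?_⟩
  · rw [← dist_eq_zero, hdist s (mem_ball_self hε) 0 t le_rfl hε, hfs,
      coneDist_zero_right hθ hθ' le_rfl]
  · obtain ⟨hb, h0⟩ := hφ r' t' h3 h4
    rw [hdist _ hb _ _ h1 h2, coneDist_comm hθ hθ']
    rw [coneDist_congr_of_eq_zero hθ hθ' (hf _ hb).1 h3 h0, coneDist_comm hθ hθ']
  · refine ⟨(f p).1, (f p).2, (hf p hp).1, (hf p hp).2, ?_⟩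
    rw [← dist_eq_zero, hdist p hp _ _ (hf p hp).1 (hf p hp).2, coneDist_self hθ hθ']

namespace IsPolarChart

theorem dist_center (h : IsPolarChart θ s ε φ) (hθ : 0 < θ) (hθ' : θ < π) {r t : ℝ} (hr : 0 ≤ r)
    (hrε : r < ε) : dist (φ r t) s = r := by
  rw [← h.zero 0, h.dist_eq r t 0 0 hr hrε le_rfl h.pos, coneDist_zero_right hθ hθ' hr]

theorem mono (h : IsPolarChart θ s ε φ) (hθ : 0 < θ) (hθ' : θ < π) {ε' : ℝ} (hε' : 0 < ε')
    (hle : ε' ≤ ε) : IsPolarChart θ s ε' φ := by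
  refine ⟨hε', h.zero, fun r t r' t' h1 h2 h3 h4 =>
    h.dist_eq r t r' t' h1 (h2.trans_le hle) h3 (h4.trans_le hle), fun p hp => ?_⟩
  obtain ⟨r, t, hr, hr', rfl⟩ := h.surj p (ball_subset_ball hle hp)
  rw [mem_ball, h.dist_center hθ hθ' hr hr'] at hp
  exact ⟨r, t, hr, hp, rfl⟩

theorem add_period (h : IsPolarChart θ s ε φ) (hθ : 0 < θ) (hθ' : θ < π) {r t : ℝ} (hr : 0 ≤ r)
    (hrε : r < ε) (k : ℤ) : φ r (t + θ * k) = φ r t := by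
  rw [← dist_eq_zero, h.dist_eq _ _ _ _ hr hrε hr hrε, coneDist_add_right hθ hθ',
    coneDist_self hθ hθ']

/-- No local geodesic passes through a cone point of angle less than `π`. -/
theorem ne_center (h : IsPolarChart θ s ε φ) (hθ : 0 < θ) (hθ' : θ < π) {c : ℝ → S} {x : ℝ}
    (hc : IsLocalGeodesicAt c x) : c x ≠ s := by
  rintro rfl
  obtain ⟨δ, hδ, hc⟩ := hc
  obtain ⟨k, hk0, hkδ, hkε⟩ : ∃ k, 0 < k ∧ k < δ ∧ k < ε :=
    ⟨min δ ε / 2, by have := lt_min hδ h.pos; positivity,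
      by linarith [min_le_left δ ε, lt_min hδ h.pos],
      by linarith [min_le_right δ ε, lt_min hδ h.pos]⟩
  have hk : |k| < δ := by rwa [abs_of_pos hk0]
  have key : ∀ y, |y - x| = k → ∃ t, c y = φ k t := by
    intro y hy
    have hd : dist (c y) (c x) = k := by
      rw [hc y x (by rw [hy]; exact hkδ) (by simpa using hδ), hy]
    obtain ⟨r, t, hr, hr', he⟩ := h.surj (c y) (by rw [mem_ball, hd]; exact hkε)
    rw [← he, h.dist_center hθ hθ' hr hr'] at hd
    exact ⟨t, by rw [← he, hd]⟩
  obtain ⟨t, ht⟩ := key (x + k) (by simp [abs_of_pos hk0])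
  obtain ⟨t', ht'⟩ := key (x - k) (by simp [abs_of_pos hk0])
  have hd := hc (x + k) (x - k) (by simpa using hk) (by simpa using hk)
  rw [ht, ht', h.dist_eq _ _ _ _ hk0.le hkε hk0.le hkε, coneDist_eq_sqrt hθ hθ',
    show x + k - (x - k) = 2 * k by ring, abs_of_pos (by positivity),
    Real.sqrt_eq_iff_mul_self_eq_of_pos (by positivity)] at hd
  have hcos : 0 < Real.cos (circleDist θ t t') := Real.cos_pos_of_mem_Ioo
    ⟨by linarith [circleDist_nonneg θ t t'], by linarith [circleDist_le hθ t t']⟩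
  have := mul_pos (mul_pos hk0 hk0) hcos
  simp only at hd
  nlinarith

end IsPolarChart

end PolarCharts

section ExponentialMaps

variable {S : Type*} {R : ℝ}

/-- The map `φ`, given in polar coordinates, as a function on a sector of the plane whose
horizontal axis has direction `t`. -/
def sectorMap (φ : ℝ → ℝ → S) (t : ℝ) (z : ℂ) : S := φ ‖z‖ (t + z.arg)

/-- The open right half of the disk of radius `R` around the origin. -/
def halfDisk (R : ℝ) : Set ℂ := {z | 0 < z.re ∧ ‖z‖ < R}

theorem convex_halfDisk (R : ℝ) : Convex ℝ (halfDisk R) := by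
  have h := (convex_halfSpace_re_gt 0).inter (convex_ball (0 : ℂ) R)
  convert h using 1
  ext z
  simp [halfDisk]

theorem isOpen_halfDisk (R : ℝ) : IsOpen (halfDisk R) :=
  (isOpen_lt continuous_const Complex.continuous_re).inter
    (isOpen_lt continuous_norm continuous_const)

theorem ofReal_mem_halfDisk {r : ℝ} : (r : ℂ) ∈ halfDisk R ↔ 0 < r ∧ r < R := by
  simp only [halfDisk, mem_ofPred_eq, Complex.ofReal_re, Complex.norm_real]
  exact and_congr_right fun h => by rw [Real.norm_of_nonneg h.le]

theorem sectorMap_ofReal (φ : ℝ → ℝ → S) (t : ℝ) {r : ℝ} (hr : 0 ≤ r) :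
    sectorMap φ t r = φ r t := by
  simp [sectorMap, Complex.arg_ofReal_of_nonneg hr, abs_of_nonneg hr]

theorem sectorMap_mul_exp_of_abs_lt (φ : ℝ → ℝ → S) (t : ℝ) {z : ℂ} (hz : z ≠ 0) {τ : ℝ}
    (h : |z.arg + τ| < π) :
    sectorMap φ t (z * Complex.exp (τ * Complex.I)) = sectorMap φ (t + τ) z := by
  rw [abs_lt] at h
  have hn : ‖z * Complex.exp (τ * Complex.I)‖ = ‖z‖ := by
    rw [norm_mul, Complex.norm_exp_ofReal_mul_I, mul_one]
  have ha : (z * Complex.exp (τ * Complex.I)).arg = z.arg + τ := by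
    have h2 : z * Complex.exp (τ * Complex.I) = (‖z‖ : ℂ) *
        (Complex.cos (z.arg + τ : ℝ) + Complex.sin (z.arg + τ : ℝ) * Complex.I) := by
      rw [← Complex.exp_mul_I]
      push_cast
      rw [add_mul, Complex.exp_add, ← mul_assoc, Complex.norm_mul_exp_arg_mul_I]
    rw [h2, Complex.arg_mul_cos_add_sin_mul_I (norm_pos_iff.2 hz) ⟨h.1, h.2.le⟩]
  rw [sectorMap, sectorMap, hn, ha]
  congr 1
  ring

theorem sectorMap_ofReal_mul_exp (φ : ℝ → ℝ → S) (t : ℝ) {r τ : ℝ} (hr : 0 < r) (hτ : |τ| < π) :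
    sectorMap φ t (r * Complex.exp (τ * Complex.I)) = φ r (t + τ) := by
  rw [sectorMap_mul_exp_of_abs_lt _ _ (by exact_mod_cast hr.ne'), sectorMap_ofReal _ _ hr.le]
  rwa [Complex.arg_ofReal_of_nonneg hr.le, zero_add]

theorem sectorMap_mul_exp (φ : ℝ → ℝ → S) (t : ℝ) {z : ℂ} (hz : 0 < z.re) {τ : ℝ}
    (hτ : |τ| ≤ π / 2) :
    sectorMap φ t (z * Complex.exp (τ * Complex.I)) = sectorMap φ (t + τ) z := by
  refine sectorMap_mul_exp_of_abs_lt _ _ (fun h => by simp [h] at hz) ?_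
  have := Complex.abs_arg_lt_pi_div_two_iff.2 (Or.inl hz)
  linarith [abs_add_le z.arg τ]

variable [MetricSpace S] {θ : ℝ} {s : S} {ε : ℝ} {φ₀ φ : ℝ → ℝ → S}

/-- `φ` extends the polar chart `φ₀` to a locally isometric map in polar coordinates, up to
radius `R`. -/
structure IsExpMap (ε : ℝ) (φ₀ : ℝ → ℝ → S) (R : ℝ) (φ : ℝ → ℝ → S) : Prop where
  le : ε ≤ R
  locIsoAt_ofReal : ∀ t r : ℝ, 0 < r → r < R → LocIsoAt (sectorMap φ t) r
  eq_chart : ∀ r t, 0 ≤ r → r < ε → φ r t = φ₀ r t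

theorem IsPolarChart.isExpMap (h : IsPolarChart θ s ε φ) (hθ : 0 < θ) (hθ' : θ < π) :
    IsExpMap ε φ ε φ := by
  refine ⟨le_rfl, fun t r hr hrε => ?_, fun _ _ _ _ => rfl⟩
  have hnorm : ∀ᶠ z : ℂ in nhds (r : ℂ), ‖z‖ < ε :=
    continuous_norm.continuousAt.eventually_lt continuousAt_const
      (by simpa [abs_of_pos hr] using hrε)
  have harg : ∀ᶠ z : ℂ in nhds (r : ℂ), |z.arg| < θ / 4 :=
    (Complex.continuousAt_arg (Complex.ofReal_mem_slitPlane.2 hr)).abs.eventually_lt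
      continuousAt_const (by simp [Complex.arg_ofReal_of_nonneg hr.le]; positivity)
  obtain ⟨δ₁, hδ₁, hball⟩ := Metric.eventually_nhds_iff_ball.1 (hnorm.and harg)
  set δ := min δ₁ (min r (ε - r)) with hδ
  have h1 : δ ≤ δ₁ := min_le_left _ _
  have h2 : δ ≤ r := (min_le_right _ _).trans (min_le_left _ _)
  have h3 : δ ≤ ε - r := (min_le_right _ _).trans (min_le_right _ _)
  have hδ0 : 0 < δ := lt_min hδ₁ (lt_min hr (by linarith))
  refine ⟨δ, hδ0, fun a ha b hb => ?_, fun p hp => ?_⟩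
  · obtain ⟨ha1, ha2⟩ := hball a (ball_subset_ball h1 ha)
    obtain ⟨hb1, hb2⟩ := hball b (ball_subset_ball h1 hb)
    have hab : |t + a.arg - (t + b.arg)| ≤ θ / 2 := by
      rw [abs_lt] at ha2 hb2
      rw [abs_le]
      constructor <;> linarith
    rw [sectorMap, sectorMap, h.dist_eq _ _ _ _ (norm_nonneg a) ha1 (norm_nonneg b) hb1,
      coneDist_eq_dist hθ hθ' hab]
    have key : ∀ a : ℂ, (‖a‖ : ℂ) * Complex.exp ((t + a.arg : ℝ) * Complex.I) =
        a * Complex.exp (t * Complex.I) := fun a => by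
      conv_rhs => rw [← Complex.norm_mul_exp_arg_mul_I a]
      push_cast
      rw [add_mul, Complex.exp_add]
      ring
    rw [key, key, dist_eq_norm, ← sub_mul, norm_mul, Complex.norm_exp_ofReal_mul_I, mul_one,
      dist_eq_norm]
  · rw [sectorMap_ofReal _ _ hr.le, mem_ball] at hp
    have hps : dist p s < ε := by
      have := dist_triangle p (φ r t) s
      rw [h.dist_center hθ hθ' hr.le hrε] at this
      linarith
    obtain ⟨r', t', hr', hrε', rfl⟩ := h.surj p hps
    have hr0 : 0 < r' := by
      refine hr'.lt_of_ne' fun h0 => ?_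
      rw [h0, h.zero, dist_comm, h.dist_center hθ hθ' hr.le hrε] at hp
      linarith
    set k := round ((t' - t) / θ) with hk
    set τ := t' - t - θ * k with hτ
    have hτθ : |τ| ≤ θ / 2 := circleDist_le hθ t' t
    have he : φ r' t' = φ r' (t + τ) := by
      rw [← h.add_period hθ hθ' (t := t + τ) hr' hrε' k]
      congr 1
      rw [hτ]
      ring
    refine ⟨r' * Complex.exp (τ * Complex.I), ?_, ?_⟩
    · rw [he, h.dist_eq _ _ _ _ hr' hrε' hr.le hrε, coneDist_eq_dist hθ hθ' (by simpa using hτθ)]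
        at hp
      rw [mem_ball]
      convert hp using 1
      rw [dist_eq_norm, dist_eq_norm, Complex.ofReal_add, add_mul, Complex.exp_add]
      rw [show ((r' : ℂ) * (Complex.exp (t * Complex.I) * Complex.exp (τ * Complex.I)) -
        r * Complex.exp (t * Complex.I)) =
        (r' * Complex.exp (τ * Complex.I) - r) * Complex.exp (t * Complex.I) by ring, norm_mul,
        Complex.norm_exp_ofReal_mul_I, mul_one]
    · rw [he, sectorMap_ofReal_mul_exp _ _ hr0 (by linarith)]

theorem LocIsoAt.isLocalGeodesicAt {F : ℂ → S} {r : ℝ} (h : LocIsoAt F r) :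
    IsLocalGeodesicAt (fun x : ℝ => F x) r := by
  obtain ⟨δ, hδ, h⟩ := h
  refine ⟨δ, hδ, fun x y hx hy => ?_⟩
  have key : ∀ x : ℝ, |x - r| < δ → (x : ℂ) ∈ ball (r : ℂ) δ := fun x hx => by
    rwa [mem_ball, Complex.dist_of_im_eq (by simp), Complex.ofReal_re, Complex.ofReal_re,
      Real.dist_eq]
  rw [h.1 _ (key x hx) _ (key y hy), Complex.dist_of_im_eq (by simp), Complex.ofReal_re,
    Complex.ofReal_re, Real.dist_eq]

namespace IsExpMap

theorem locIsoAt (h : IsExpMap ε φ₀ R φ) (t : ℝ) {z : ℂ} (hz : z ∈ halfDisk R) :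
    LocIsoAt (sectorMap φ t) z := by
  obtain ⟨hre, hR⟩ := hz
  have hz0 : z ≠ 0 := fun h => by simp [h] at hre
  have harg := (Complex.abs_arg_lt_pi_div_two_iff.2 (Or.inl hre))
  have hu : ‖Complex.exp ((-z.arg : ℝ) * Complex.I)‖ = 1 := Complex.norm_exp_ofReal_mul_I _
  have hA : directIso _ 0 hu z = (‖z‖ : ℂ) := by
    rw [directIso_apply, zero_add]
    conv_lhs => rw [← Complex.norm_mul_exp_arg_mul_I z]
    rw [mul_comm, mul_assoc, ← Complex.exp_add]
    simp
  have hloc := h.locIsoAt_ofReal (t + z.arg) ‖z‖ (norm_pos_iff.2 hz0) hR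
  rw [← hA] at hloc
  refine hloc.comp_isometry.congr ?_
  have hev : ∀ᶠ w in nhds z, 0 < (directIso _ 0 hu w).re := by
    refine continuousAt_const.eventually_lt
      (Complex.continuous_re.comp (directIso _ 0 hu).continuous).continuousAt ?_
    rw [hA]
    simpa using hz0
  filter_upwards [hev] with w hw
  rw [← sectorMap_mul_exp φ t hw harg.le, directIso_apply, zero_add, mul_comm, ← mul_assoc,
    ← Complex.exp_add]
  simp

theorem pos (h : IsExpMap ε φ₀ R φ) (h₀ : IsPolarChart θ s ε φ₀) : 0 < R := h₀.pos.trans_le h.le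

theorem zero (h : IsExpMap ε φ₀ R φ) (h₀ : IsPolarChart θ s ε φ₀) (t : ℝ) : φ 0 t = s := by
  rw [h.eq_chart 0 t le_rfl h₀.pos, h₀.zero]

theorem ne_center (h : IsExpMap ε φ₀ R φ) (h₀ : IsPolarChart θ s ε φ₀) (hθ : 0 < θ) (hθ' : θ < π)
    {r : ℝ} (hr : 0 < r) (hrR : r < R) (t : ℝ) : φ r t ≠ s := by
  have := h₀.ne_center hθ hθ' (h.locIsoAt_ofReal t r hr hrR).isLocalGeodesicAt
  rwa [sectorMap_ofReal _ _ hr.le] at this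

theorem mono (h : IsExpMap ε φ₀ R φ) {R' : ℝ} (hε : ε ≤ R') (hR' : R' ≤ R) :
    IsExpMap ε φ₀ R' φ :=
  ⟨hε, fun t r hr hrR => h.locIsoAt_ofReal t r hr (hrR.trans_le hR'), h.eq_chart⟩

theorem congr (h : IsExpMap ε φ₀ R φ) {ψ : ℝ → ℝ → S}
    (hψ : ∀ r t, 0 ≤ r → r < R → ψ r t = φ r t) : IsExpMap ε φ₀ R ψ := by
  refine ⟨h.le, fun t r hr hrR => ?_, fun r t hr hrε => ?_⟩
  · refine (h.locIsoAt_ofReal t r hr hrR).congr ?_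
    filter_upwards [(isOpen_halfDisk R).mem_nhds (ofReal_mem_halfDisk.2 ⟨hr, hrR⟩)] with z hz
    rw [sectorMap, sectorMap, hψ _ _ (norm_nonneg z) hz.2]
  · rw [hψ r t hr (hrε.trans_le h.le), h.eq_chart r t hr hrε]

theorem sectorMap_eqOn (h : IsExpMap ε φ₀ R φ) (h₀ : IsPolarChart θ s ε φ₀) {ψ : ℝ → ℝ → S}
    (hψ : IsExpMap ε φ₀ R ψ) {t t' : ℝ} (ht : ∀ r α, 0 ≤ r → r < ε → φ₀ r (t + α) = φ₀ r (t' + α))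
    {z : ℂ} (hz : z ∈ halfDisk R) : sectorMap φ t z = sectorMap ψ t' z := by
  have hε : ((ε / 2 : ℝ) : ℂ) ∈ halfDisk ε :=
    ofReal_mem_halfDisk.2 ⟨half_pos h₀.pos, half_lt_self h₀.pos⟩
  have hεR : halfDisk ε ⊆ halfDisk R := fun z hz => ⟨hz.1, hz.2.trans_le h.le⟩
  refine (LocIsoAt.eqOn (convex_halfDisk R).isPreconnected (fun z hz => h.locIsoAt t hz)
    (fun z hz => hψ.locIsoAt t' hz) (hεR hε) ?_ z hz).self_of_nhds
  filter_upwards [(isOpen_halfDisk ε).mem_nhds hε] with w hw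
  rw [sectorMap, sectorMap, h.eq_chart _ _ (norm_nonneg w) hw.2, hψ.eq_chart _ _ (norm_nonneg w) hw.2,
    ht _ _ (norm_nonneg w) hw.2]

theorem eq (h : IsExpMap ε φ₀ R φ) (h₀ : IsPolarChart θ s ε φ₀) {ψ : ℝ → ℝ → S}
    (hψ : IsExpMap ε φ₀ R ψ) {r : ℝ} (hr : 0 ≤ r) (hrR : r < R) (t : ℝ) : φ r t = ψ r t := by
  obtain rfl | hr := hr.eq_or_lt
  · rw [h.zero h₀, hψ.zero h₀]
  · rw [← sectorMap_ofReal φ t hr.le, ← sectorMap_ofReal ψ t hr.le]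
    exact h.sectorMap_eqOn h₀ hψ (fun _ _ _ _ => rfl) (ofReal_mem_halfDisk.2 ⟨hr, hrR⟩)

theorem sectorMap_add_period (h : IsExpMap ε φ₀ R φ) (h₀ : IsPolarChart θ s ε φ₀) (hθ : 0 < θ)
    (hθ' : θ < π) (t : ℝ) (k : ℤ) {z : ℂ} (hz : z ∈ halfDisk R) :
    sectorMap φ (t + θ * k) z = sectorMap φ t z := by
  refine h.sectorMap_eqOn h₀ h (fun r α hr hrε => ?_) hz
  rw [add_right_comm, h₀.add_period hθ hθ' hr hrε]

theorem add_period (h : IsExpMap ε φ₀ R φ) (h₀ : IsPolarChart θ s ε φ₀) (hθ : 0 < θ)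
    (hθ' : θ < π) {r : ℝ} (hr : 0 ≤ r) (hrR : r < R) (t : ℝ) (k : ℤ) :
    φ r (t + θ * k) = φ r t := by
  obtain rfl | hr := hr.eq_or_lt
  · rw [h.zero h₀, h.zero h₀]
  · rw [← sectorMap_ofReal φ t hr.le, ← sectorMap_ofReal φ _ hr.le]
    exact h.sectorMap_add_period h₀ hθ hθ' t k (ofReal_mem_halfDisk.2 ⟨hr, hrR⟩)

theorem exists_mem_Ico (h : IsExpMap ε φ₀ R φ) (h₀ : IsPolarChart θ s ε φ₀) (hθ : 0 < θ)
    (hθ' : θ < π) (t : ℝ) : ∃ t' ∈ Ico 0 θ, ∀ r, 0 ≤ r → r < R → φ r t = φ r t' := by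
  refine ⟨toIcoMod hθ 0 t, by simpa using toIcoMod_mem_Ico hθ 0 t, fun r hr hrR => ?_⟩
  rw [← h.add_period h₀ hθ hθ' hr hrR (toIcoMod hθ 0 t) (toIcoDiv hθ 0 t)]
  congr 1
  conv_lhs => rw [← toIcoMod_add_toIcoDiv_zsmul hθ 0 t]
  rw [zsmul_eq_mul, mul_comm]

theorem dist_le (h : IsExpMap ε φ₀ R φ) {r r' : ℝ} (hr : 0 < r) (hrR : r < R) (hr' : 0 < r')
    (hrR' : r' < R) (t : ℝ) : dist (φ r t) (φ r' t) ≤ |r - r'| := by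
  have := LocIsoAt.dist_le (convex_halfDisk R) (fun z hz => h.locIsoAt t hz)
    (ofReal_mem_halfDisk.2 ⟨hr, hrR⟩) (ofReal_mem_halfDisk.2 ⟨hr', hrR'⟩)
  rwa [sectorMap_ofReal _ _ hr.le, sectorMap_ofReal _ _ hr'.le, Complex.dist_of_im_eq (by simp),
    Complex.ofReal_re, Complex.ofReal_re, Real.dist_eq] at this

theorem dist_center_le (h : IsExpMap ε φ₀ R φ) (h₀ : IsPolarChart θ s ε φ₀) (hθ : 0 < θ)
    (hθ' : θ < π) {r : ℝ} (hr : 0 ≤ r) (hrR : r < R) (t : ℝ) : dist (φ r t) s ≤ r := by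
  by_cases hrε : r < ε
  · rw [h.eq_chart r t hr hrε, h₀.dist_center hθ hθ' hr hrε]
  · have hε := h₀.pos
    rw [not_lt] at hrε
    have h1 := h.dist_le (hε.trans_le hrε) hrR (half_pos hε) (by linarith) t
    have h2 := h.eq_chart (ε / 2) t (by linarith) (by linarith)
    have h3 := h₀.dist_center hθ hθ' (t := t) (half_pos hε).le (by linarith)
    rw [abs_of_pos (by linarith), h2] at h1
    linarith [dist_triangle (φ r t) (φ₀ (ε / 2) t) s]

theorem continuousAt (h : IsExpMap ε φ₀ R φ) {p : ℝ × ℝ} (hp : 0 < p.1) (hpR : p.1 < R) :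
    ContinuousAt (fun p : ℝ × ℝ => φ p.1 p.2) p := by
  set k : ℝ × ℝ → ℂ := fun q => q.1 * Complex.exp ((q.2 - p.2 : ℝ) * Complex.I) with hk
  have hkc : Continuous k := by fun_prop
  have hkp : k p = (p.1 : ℂ) := by simp [hk]
  have hF : ContinuousAt (sectorMap φ p.2) (k p) := by
    rw [hkp]
    exact (h.locIsoAt_ofReal p.2 p.1 hp hpR).continuousAt
  refine (ContinuousAt.comp hF hkc.continuousAt).congr ?_
  have h1 : ∀ᶠ q : ℝ × ℝ in nhds p, 0 < q.1 :=
    continuousAt_const.eventually_lt continuous_fst.continuousAt hp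
  have h2 : ∀ᶠ q : ℝ × ℝ in nhds p, |q.2 - p.2| < π :=
    ((continuous_snd.sub continuous_const).abs).continuousAt.eventually_lt continuousAt_const
      (by simpa using pi_pos)
  filter_upwards [h1, h2] with q h1 h2
  rw [Function.comp_apply, hk, sectorMap_ofReal_mul_exp _ _ h1 h2]
  congr 1
  ring

end IsExpMap

end ExponentialMaps

section Lines

variable {S : Type*} [MetricSpace S] {θ : ℝ} {s : S} {ε R : ℝ} {φ₀ φ : ℝ → ℝ → S}

theorem sq_norm_mk (a b : ℝ) : ‖(⟨a, b⟩ : ℂ)‖ ^ 2 = a ^ 2 + b ^ 2 := by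
  rw [← Complex.normSq_eq_norm_sq, Complex.normSq_mk]
  ring

theorem mk_mem_halfDisk {a b : ℝ} (hR : 0 ≤ R) :
    (⟨a, b⟩ : ℂ) ∈ halfDisk R ↔ 0 < a ∧ a ^ 2 + b ^ 2 < R ^ 2 := by
  rw [halfDisk, mem_ofPred_eq, ← sq_norm_mk, sq_lt_sq₀ (norm_nonneg _) hR]

/-- A local geodesic meeting the image of an exponential map follows either a ray or a straight
line at positive distance from the vertex. -/
theorem IsExpMap.radial_or_line (h : IsExpMap ε φ₀ R φ) {c : ℝ → S} {I : Set ℝ}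
    (hI : Convex ℝ I) (hc : ∀ x ∈ I, IsLocalGeodesicAt c x) {x₀ ρ t₀ : ℝ} (hx₀ : x₀ ∈ I)
    (hρ : 0 < ρ) (hρR : ρ < R) (hcx : c x₀ = φ ρ t₀) :
    (∃ σ : ℝ, (σ = 1 ∨ σ = -1) ∧ ∀ x ∈ I, 0 < ρ + σ * (x - x₀) → ρ + σ * (x - x₀) < R →
      c x = φ (ρ + σ * (x - x₀)) t₀) ∨
    ∃ a t σ x₁ : ℝ, (σ = 1 ∨ σ = -1) ∧ 0 < a ∧ a ≤ ρ ∧ a ^ 2 + (x₀ - x₁) ^ 2 = ρ ^ 2 ∧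
      ∀ x ∈ I, a ^ 2 + (x - x₁) ^ 2 < R ^ 2 → c x = sectorMap φ t ⟨a, σ * (x - x₁)⟩ := by
  obtain ⟨e, he, hline⟩ := (h.locIsoAt_ofReal t₀ ρ hρ hρR).exists_line (hc x₀ hx₀)
    (by rw [sectorMap_ofReal _ _ hρ.le, hcx])
  have hsq := Complex.re_sq_add_im_sq_of_norm_eq_one he
  by_cases him : e.im = 0
  · left
    refine ⟨e.re, sq_eq_one_iff.1 (by simpa [him] using hsq), fun x hx h1 h2 => ?_⟩
    have key : ∀ x : ℝ, (ρ : ℂ) + ((x - x₀ : ℝ) : ℂ) * e = ((ρ + e.re * (x - x₀) : ℝ) : ℂ) :=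
      fun x => Complex.ext (by simp; ring) (by simp [him])
    have := IsLocalGeodesicAt.eq_line hI hc (convex_halfDisk R) (fun z hz => h.locIsoAt t₀ hz)
      hx₀ (by rw [key, ofReal_mem_halfDisk]; simp [hρ, hρR]) hline hx
      (by rw [key, ofReal_mem_halfDisk]; exact ⟨h1, h2⟩)
    rwa [key, sectorMap_ofReal _ _ h1.le] at this
  · right
    obtain ⟨σ, hσ, hσe⟩ : ∃ σ : ℝ, (σ = 1 ∨ σ = -1) ∧ 0 < σ * e.im := by
      rcases lt_or_gt_of_ne him with h | h
      · exact ⟨-1, Or.inr rfl, by linarith⟩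
      · exact ⟨1, Or.inl rfl, by linarith⟩
    have hσ2 : σ ^ 2 = 1 := by rcases hσ with rfl | rfl <;> norm_num
    set u : ℂ := ⟨σ * e.im, -(σ * e.re)⟩ with hu
    have hnu : ‖u‖ = 1 := by
      have : ‖u‖ ^ 2 = 1 := by
        rw [hu, sq_norm_mk]
        linear_combination hsq + (e.re ^ 2 + e.im ^ 2) * hσ2
      exact (pow_eq_one_iff_of_nonneg (norm_nonneg u) two_ne_zero).1 this
    have hψ : |u.arg| ≤ π / 2 :=
      (Complex.abs_arg_lt_pi_div_two_iff.2 (Or.inl hσe)).le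
    have hue : Complex.exp (u.arg * Complex.I) = u := by
      have := Complex.norm_mul_exp_arg_mul_I u
      rwa [hnu, Complex.ofReal_one, one_mul] at this
    set a := ρ * (σ * e.im) with ha
    set x₁ := x₀ - ρ * e.re with hx₁
    have ha0 : 0 < a := mul_pos hρ hσe
    have hsum : a ^ 2 + (x₀ - x₁) ^ 2 = ρ ^ 2 := by
      rw [ha, hx₁]
      linear_combination ρ ^ 2 * hsq + ρ ^ 2 * e.im ^ 2 * hσ2
    have key : ∀ x : ℝ, (a : ℂ) + ((x - x₁ : ℝ) : ℂ) * ⟨0, σ⟩ = ⟨a, σ * (x - x₁)⟩ :=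
      fun x => Complex.ext (by simp) (by simp; ring)
    have hmul : ∀ x : ℝ, (ρ : ℂ) + ((x - x₀ : ℝ) : ℂ) * e = ⟨a, σ * (x - x₁)⟩ * u := by
      intro x
      refine Complex.ext ?_ ?_
      · simp only [Complex.add_re, Complex.mul_re, Complex.ofReal_re, Complex.ofReal_im, hu, ha,
          hx₁]
        linear_combination -ρ * hsq - (ρ * e.im ^ 2 + (x - x₀ + ρ * e.re) * e.re) * hσ2
      · simp only [Complex.add_im, Complex.mul_im, Complex.ofReal_re, Complex.ofReal_im, hu, ha,
          hx₁]
        linear_combination -((x - x₀) * e.im) * hσ2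
    have hR : 0 ≤ R := (hρ.trans hρR).le
    refine ⟨a, t₀ + u.arg, σ, x₁, hσ, ha0, ?_, hsum, fun x hx hxR => ?_⟩
    · exact abs_le_of_sq_le_sq' (by nlinarith [sq_nonneg (x₀ - x₁)]) hρ.le |>.2
    have hσx : ∀ x : ℝ, (σ * (x - x₁)) ^ 2 = (x - x₁) ^ 2 := fun x => by
      rw [mul_pow, hσ2, one_mul]
    have := IsLocalGeodesicAt.eq_line hI hc (convex_halfDisk R)
      (fun z hz => h.locIsoAt (t₀ + u.arg) hz) (z := a) (e := ⟨0, σ⟩) (x₁ := x₁) hx₀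
      (by rw [key, mk_mem_halfDisk hR, hσx, hsum]; exact ⟨ha0, by nlinarith⟩)
      (by
        filter_upwards [hline] with x hx
        rw [hx, key, hmul, ← sectorMap_mul_exp _ _ (by exact ha0) hψ, hue]) hx
      (by rw [key, mk_mem_halfDisk hR, hσx]; exact ⟨ha0, hxR⟩)
    rwa [key] at this

end Lines

section Loops

/-- The set of points at distance less than `R` from both ends of the segment `[0, R]` that
project into its interior. -/
def lens (R : ℝ) : Set ℂ := {z | z ∈ halfDisk R ∧ (R : ℂ) - z ∈ halfDisk R}

theorem isOpen_lens (R : ℝ) : IsOpen (lens R) :=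
  (isOpen_halfDisk R).inter ((isOpen_halfDisk R).preimage (continuous_const.sub continuous_id))

theorem convex_lens (R : ℝ) : Convex ℝ (lens R) := by
  refine (convex_halfDisk R).inter fun a ha b hb x y hx hy hxy => ?_
  have := convex_halfDisk R ha hb hx hy hxy
  have h : (x : ℂ) + y = 1 := by exact_mod_cast hxy
  show (R : ℂ) - (x • a + y • b) ∈ halfDisk R
  simp only [Complex.real_smul] at this ⊢
  convert this using 1
  linear_combination -(R : ℂ) * h

theorem conj_mem_halfDisk {R : ℝ} {z : ℂ} : (starRingEnd ℂ) z ∈ halfDisk R ↔ z ∈ halfDisk R := by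
  simp [halfDisk]

theorem sub_conj_mem_halfDisk {R : ℝ} {z : ℂ} (hz : z ∈ lens R) :
    (R : ℂ) - (starRingEnd ℂ) z ∈ halfDisk R := by
  rw [← conj_mem_halfDisk]
  simpa using hz.2

theorem half_mem_lens {R : ℝ} (hR : 0 < R) : ((R / 2 : ℝ) : ℂ) ∈ lens R := by
  have h : ((R / 2 : ℝ) : ℂ) ∈ halfDisk R :=
    ofReal_mem_halfDisk.2 ⟨half_pos hR, half_lt_self hR⟩
  refine ⟨h, ?_⟩
  convert h using 1
  push_cast
  ring

theorem ofReal_mul_exp_mem_halfDisk {R a α : ℝ} (ha : 0 < a) (haR : a < R) (hα : |α| < π / 2) :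
    (a : ℂ) * Complex.exp (α * Complex.I) ∈ halfDisk R := by
  refine ⟨?_, ?_⟩
  · rw [Complex.re_ofReal_mul, Complex.exp_ofReal_mul_I_re]
    exact mul_pos ha (Real.cos_pos_of_mem_Ioo (abs_lt.1 hα))
  · rwa [norm_mul, Complex.norm_exp_ofReal_mul_I, mul_one, Complex.norm_real,
      Real.norm_of_nonneg ha.le]

theorem arg_ofReal_mul_exp {a α : ℝ} (ha : 0 < a) (hα : |α| < π) :
    ((a : ℂ) * Complex.exp (α * Complex.I)).arg = α := by
  rw [abs_lt] at hα
  rw [Complex.exp_mul_I, Complex.arg_mul_cos_add_sin_mul_I ha ⟨hα.1, hα.2.le⟩]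

variable {S : Type*} [MetricSpace S] {θ : ℝ} {s : S} {ε R : ℝ} {φ₀ φ : ℝ → ℝ → S}

/-- A local isometry that is locally invariant under a rigid motion near a fixed point of it. -/
theorem LocIsoAt.eq_self_of_eventually {F : ℂ → S} {z : ℂ} (hF : LocIsoAt F z) (A : ℂ ≃ᵢ ℂ)
    (hA : A z = z) (h : ∀ᶠ w in nhds z, F w = F (A w)) (a : ℂ) : A a = a := by
  have hinj := hF.eventually_eq (k := id) (l := A) continuousAt_id A.continuous.continuousAt rfl hA
  refine isometryEquiv_eq_self_of_eventually (y := z) ?_ a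
  filter_upwards [h, hinj] with w h1 h2
  exact (h2 h1).symm

namespace IsExpMap

theorem not_rotational_overlap (h : IsExpMap ε φ₀ R φ) (h₀ : IsPolarChart θ s ε φ₀) (hθ : 0 < θ)
    (hθ' : θ < π) (t τ : ℝ) :
    ¬∀ z ∈ lens R, sectorMap φ t z = sectorMap φ τ (R - z) := by
  intro H
  have hR := h.pos h₀
  set k := round ((τ - t) / θ) with hk
  set α := τ - t - θ * k with hα
  have hαθ : |α| ≤ θ / 2 := circleDist_le hθ τ t
  have hτ : τ = t + α + θ * k := by rw [hα]; ring
  have hα2 : |α / 2| < π / 4 := by rw [abs_div, abs_two]; linarith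
  have hcos : 0 < Real.cos (α / 2) := Real.cos_pos_of_mem_Ioo <| abs_lt.1 (by linarith [pi_pos])
  have hcos2 : 1 / 2 < Real.cos (α / 2) := by
    rw [← Real.cos_abs, ← Real.cos_pi_div_three]
    exact Real.cos_lt_cos_of_nonneg_of_le_pi (abs_nonneg _) (by linarith [pi_pos])
      (by linarith [pi_pos])
  set b := R / (2 * Real.cos (α / 2)) with hb
  have hb0 : 0 < b := by positivity
  have hbR : b < R := by
    rw [hb, div_lt_iff₀ (by positivity)]
    nlinarith
  set z : ℂ := b * Complex.exp ((α / 2 : ℝ) * Complex.I) with hz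
  have hzH : z ∈ halfDisk R := ofReal_mul_exp_mem_halfDisk hb0 hbR (by linarith [pi_pos])
  have hRz : (R : ℂ) - z = b * Complex.exp ((-(α / 2) : ℝ) * Complex.I) := by
    rw [hz, Complex.exp_mul_I, Complex.exp_mul_I, ← Complex.ofReal_cos, ← Complex.ofReal_cos,
      ← Complex.ofReal_sin, ← Complex.ofReal_sin, Real.cos_neg, Real.sin_neg]
    have : R = 2 * b * Real.cos (α / 2) := by rw [hb]; field_simp
    have : (R : ℂ) = 2 * b * (Real.cos (α / 2) : ℝ) := by exact_mod_cast this
    push_cast at this ⊢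
    linear_combination this
  have hRzH : (R : ℂ) - z ∈ halfDisk R := by
    rw [hRz]
    exact ofReal_mul_exp_mem_halfDisk hb0 hbR (by rw [abs_neg]; linarith [pi_pos])
  have hu : ‖-Complex.exp (α * Complex.I)‖ = 1 := by
    rw [norm_neg, Complex.norm_exp_ofReal_mul_I]
  have hA : ∀ w, directIso _ (R * Complex.exp (α * Complex.I)) hu w =
      (R - w) * Complex.exp (α * Complex.I) := fun w => by rw [directIso_apply]; ring
  have key := (h.locIsoAt t hzH).eq_self_of_eventually
    (directIso _ (R * Complex.exp (α * Complex.I)) hu) (by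
      rw [hA, hRz, hz, mul_assoc, ← Complex.exp_add]
      congr 2
      push_cast
      ring) (by
      filter_upwards [(isOpen_lens R).mem_nhds ⟨hzH, hRzH⟩] with w hw
      rw [hA, sectorMap_mul_exp _ _ hw.2.1 (by linarith), H w hw, hτ,
        h.sectorMap_add_period h₀ hθ hθ' _ _ hw.2]) 0
  rw [hA, sub_zero] at key
  exact mul_ne_zero (by exact_mod_cast hR.ne') (Complex.exp_ne_zero _) key

theorem not_reversing_overlap (h : IsExpMap ε φ₀ R φ) (h₀ : IsPolarChart θ s ε φ₀) (hθ : 0 < θ)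
    (hθ' : θ < π) (t τ : ℝ) :
    ¬∀ z ∈ lens R, sectorMap φ t z = sectorMap φ τ (R - (starRingEnd ℂ) z) := by
  intro H
  have hR := h.pos h₀
  obtain ⟨α, k, hα0, hαθ, rfl⟩ : ∃ (α : ℝ) (k : ℤ), 0 ≤ α ∧ α < θ ∧ τ = t + α + θ * k := by
    refine ⟨toIcoMod hθ 0 (τ - t), toIcoDiv hθ 0 (τ - t), ?_, ?_, ?_⟩
    · exact left_le_toIcoMod hθ 0 _
    · simpa using toIcoMod_lt_right hθ 0 (τ - t)
    · have := toIcoMod_add_toIcoDiv_zsmul hθ 0 (τ - t)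
      rw [zsmul_eq_mul] at this
      linarith
  replace H : ∀ z ∈ lens R, sectorMap φ t z = sectorMap φ (t + α) (R - (starRingEnd ℂ) z) :=
    fun z hz => by rw [H z hz, h.sectorMap_add_period h₀ hθ hθ' _ _ (sub_conj_mem_halfDisk hz)]
  obtain rfl | hα0 := hα0.eq_or_lt
  · have hA : ∀ w, reversingIso (-1) R (by simp) w = R - (starRingEnd ℂ) w := fun w => by
      rw [reversingIso_apply]; ring
    have key := (h.locIsoAt t (half_mem_lens hR).1).eq_self_of_eventually
      (reversingIso (-1) R (by simp)) (by rw [hA, Complex.conj_ofReal]; push_cast; ring) (by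
        filter_upwards [(isOpen_lens R).mem_nhds (half_mem_lens hR)] with w hw
        rw [hA, H w hw, add_zero]) 0
    rw [hA, map_zero, sub_zero] at key
    exact hR.ne' (by exact_mod_cast key)
  have hsθ : 0 < Real.sin (θ / 2) := Real.sin_pos_of_pos_of_lt_pi (by linarith) (by linarith)
  have hsα : 0 < Real.sin (α / 2) := Real.sin_pos_of_pos_of_lt_pi (by linarith) (by linarith)
  have hsβ : 0 < Real.sin ((θ - α) / 2) := Real.sin_pos_of_pos_of_lt_pi (by linarith) (by linarith)
  set a := R * (Real.sin (α / 2) / Real.sin (θ / 2)) with ha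
  set b := R * (Real.sin ((θ - α) / 2) / Real.sin (θ / 2)) with hb
  have ha0 : 0 < a := by positivity
  have hb0 : 0 < b := by positivity
  have haR : a < R := mul_lt_of_lt_one_right hR <| (div_lt_one hsθ).2 <|
    Real.sin_lt_sin_of_lt_of_le_pi_div_two (by linarith) (by linarith) (by linarith)
  have hbR : b < R := mul_lt_of_lt_one_right hR <| (div_lt_one hsθ).2 <|
    Real.sin_lt_sin_of_lt_of_le_pi_div_two (by linarith) (by linarith) (by linarith)
  have hab1 : a * Real.cos ((θ - α) / 2) + b * Real.cos (α / 2) = R := by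
    rw [ha, hb]
    have : Real.sin (θ / 2) = Real.sin (α / 2) * Real.cos ((θ - α) / 2) +
        Real.cos (α / 2) * Real.sin ((θ - α) / 2) := by
      rw [← Real.sin_add]; congr 1; ring
    field_simp
    linarith
  have hab2 : a * Real.sin ((θ - α) / 2) = b * Real.sin (α / 2) := by
    rw [ha, hb]; ring
  have hexp : ∀ x : ℝ, Complex.exp (x * Complex.I) = Real.cos x + Real.sin x * Complex.I :=
    fun x => by rw [Complex.exp_mul_I, Complex.ofReal_cos, Complex.ofReal_sin]
  have hsum : ∀ y : ℝ, y = 1 ∨ y = -1 → (R : ℂ) - a * Complex.exp ((y * ((α - θ) / 2) : ℝ) *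
      Complex.I) = b * Complex.exp ((y * (α / 2) : ℝ) * Complex.I) := by
    have e1 : (α - θ) / 2 = -((θ - α) / 2) := by ring
    have hab1' : (a : ℂ) * (Real.cos ((θ - α) / 2) : ℝ) + b * (Real.cos (α / 2) : ℝ) = R := by
      exact_mod_cast hab1
    have hab2' : (a : ℂ) * (Real.sin ((θ - α) / 2) : ℝ) = b * (Real.sin (α / 2) : ℝ) := by
      exact_mod_cast hab2
    rintro y (rfl | rfl)
    · rw [one_mul, one_mul, hexp, hexp, e1, Real.cos_neg, Real.sin_neg, Complex.ofReal_neg]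
      linear_combination -hab1' + Complex.I * hab2'
    · rw [neg_one_mul, neg_one_mul, e1, neg_neg, hexp, hexp, Real.cos_neg, Real.sin_neg,
        Complex.ofReal_neg]
      linear_combination -hab1' - Complex.I * hab2'
  have hconj : ∀ x y : ℝ, (starRingEnd ℂ) (x * Complex.exp (y * Complex.I)) =
      x * Complex.exp ((-y : ℝ) * Complex.I) := fun x y => by
    rw [map_mul, Complex.conj_ofReal, ← Complex.exp_conj]
    simp
  have hβ2 : |(α - θ) / 2| < π / 2 := by rw [abs_lt]; constructor <;> linarith
  have hα2 : |α / 2| < π / 2 := by rw [abs_lt]; constructor <;> linarith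
  set z : ℂ := a * Complex.exp (((α - θ) / 2 : ℝ) * Complex.I) with hz
  set w : ℂ := b * Complex.exp ((α / 2 : ℝ) * Complex.I) with hw
  have hzH : z ∈ halfDisk R := ofReal_mul_exp_mem_halfDisk ha0 haR hβ2
  have hwH : w ∈ halfDisk R := ofReal_mul_exp_mem_halfDisk hb0 hbR hα2
  have hRz : (R : ℂ) - z = w := by
    have := hsum 1 (Or.inl rfl)
    rwa [one_mul, one_mul] at this
  have hzL : z ∈ lens R := ⟨hzH, by rwa [hRz]⟩
  have hwL : w ∈ lens R := ⟨hwH, by rwa [← hRz, sub_sub_cancel]⟩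
  have hRz' : (R : ℂ) - (starRingEnd ℂ) z = b * Complex.exp ((-(α / 2) : ℝ) * Complex.I) := by
    rw [hz, hconj]; simpa using hsum (-1) (Or.inr rfl)
  have hRw' : (R : ℂ) - (starRingEnd ℂ) w =
      a * Complex.exp ((-((α - θ) / 2) : ℝ) * Complex.I) := by
    have := hsum (-1) (Or.inr rfl)
    rw [neg_one_mul, neg_one_mul] at this
    rw [hw, hconj, ← this, sub_sub_cancel]
  set k₁ : ℂ → ℂ := fun x => (R - (starRingEnd ℂ) x) * Complex.exp (α * Complex.I) with hk₁
  set k₂ : ℂ → ℂ := fun x => (R - (starRingEnd ℂ) x) * Complex.exp ((α - θ : ℝ) * Complex.I)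
    with hk₂
  have hk₁c : Continuous k₁ := by fun_prop
  have hk₂c : Continuous k₂ := by fun_prop
  have hk₁z : k₁ z = w := by
    simp only [hk₁]
    rw [hRz', mul_assoc, ← Complex.exp_add, hw]
    congr 2
    push_cast
    ring
  have hk₂w : k₂ w = z := by
    simp only [hk₂]
    rw [hRw', mul_assoc, ← Complex.exp_add, hz]
    congr 2
    push_cast
    ring
  have hslit : ∀ {x : ℂ}, x ∈ halfDisk R → x ∈ Complex.slitPlane := fun hx => Or.inl hx.1
  have hshift : ∀ {x : ℂ}, x ∈ lens R → ∀ {β : ℝ},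
      |((R : ℂ) - (starRingEnd ℂ) x).arg + β| < π → ∀ᶠ y in nhds x,
        sectorMap φ (t + α) (R - (starRingEnd ℂ) y) =
          sectorMap φ (t + α - β) ((R - (starRingEnd ℂ) y) * Complex.exp (β * Complex.I)) := by
    intro x hx β hβ
    have hc : Continuous fun y : ℂ => (R : ℂ) - (starRingEnd ℂ) y := by fun_prop
    have h1 : ContinuousAt (fun y : ℂ => |((R : ℂ) - (starRingEnd ℂ) y).arg + β|) x :=
      ((ContinuousAt.comp (g := Complex.arg) (f := fun y : ℂ => (R : ℂ) - (starRingEnd ℂ) y)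
        (Complex.continuousAt_arg (hslit (sub_conj_mem_halfDisk hx))) hc.continuousAt).add
        continuousAt_const).abs
    filter_upwards [h1.eventually_lt continuousAt_const hβ, (isOpen_lens R).mem_nhds hx]
      with y h1 h2
    have h3 := sub_conj_mem_halfDisk h2
    rw [sectorMap_mul_exp_of_abs_lt _ _ (fun h0 => by rw [h0] at h3; simpa using h3.1) h1,
      sub_add_cancel]
  have hF₁ : ∀ᶠ x in nhds z, sectorMap φ t x = sectorMap φ t (k₁ x) := by
    filter_upwards [hshift hzL (β := α) (by
      rw [hRz', arg_ofReal_mul_exp hb0 (by rw [abs_neg]; linarith [pi_pos]), abs_lt]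
      constructor <;> linarith), (isOpen_lens R).mem_nhds hzL] with x h1 h2
    rw [H x h2, h1, add_sub_cancel_right]
  have hF₂ : ∀ᶠ x in nhds w, sectorMap φ t x = sectorMap φ t (k₂ x) := by
    filter_upwards [hshift hwL (β := α - θ) (by
      rw [hRw', arg_ofReal_mul_exp ha0 (by rw [abs_neg]; linarith [pi_pos]), abs_lt]
      constructor <;> linarith), (isOpen_lens R).mem_nhds hwL,
      hk₂c.continuousAt.eventually ((isOpen_halfDisk R).mem_nhds (by rwa [hk₂w]))] with x h1 h2 h3
    rw [H x h2, h1, show t + α - (α - θ) = t + θ * (1 : ℤ) by push_cast; ring]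
    exact h.sectorMap_add_period h₀ hθ hθ' _ _ h3
  have hu : ‖Complex.exp ((-θ : ℝ) * Complex.I)‖ = 1 := Complex.norm_exp_ofReal_mul_I _
  set v : ℂ := k₂ (k₁ 0) with hv
  have hA : ∀ x, directIso _ v hu x = k₂ (k₁ x) := fun x => by
    rw [directIso_apply, hv]
    simp only [hk₁, hk₂, map_mul, map_sub, Complex.conj_ofReal, Complex.conj_conj, map_zero,
      ← Complex.exp_conj, Complex.conj_I]
    have e1 : Complex.exp ((-θ : ℝ) * Complex.I) = Complex.exp (α * -Complex.I) *
        Complex.exp ((α - θ : ℝ) * Complex.I) := by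
      rw [← Complex.exp_add]; congr 1; push_cast; ring
    rw [e1]
    ring
  have key := (h.locIsoAt t hzH).eq_self_of_eventually (directIso _ v hu)
    (by rw [hA, hk₁z, hk₂w]) (by
      have h2 := hk₁c.continuousAt.eventually (by rwa [hk₁z] : ∀ᶠ x in nhds (k₁ z), _)
      filter_upwards [hF₁, h2] with x h1 h2
      rw [hA, h1, h2])
  have h1 := key 1
  have h2 := key 0
  rw [directIso_apply, mul_zero, add_zero] at h2
  rw [directIso_apply, h2, zero_add, mul_one] at h1
  have h3 := congrArg Complex.im h1
  rw [Complex.exp_ofReal_mul_I_im, Real.sin_neg, Complex.one_im] at h3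
  linarith [Real.sin_pos_of_pos_of_lt_pi hθ hθ']

end IsExpMap

end Loops

section NonReturn

variable {S : Type*} [MetricSpace S] {θ : ℝ} {s : S} {ε R : ℝ} {φ₀ φ : ℝ → ℝ → S}

namespace IsExpMap

theorem not_ray_eq_reversed_ray (h : IsExpMap ε φ₀ R φ) (h₀ : IsPolarChart θ s ε φ₀) (hθ : 0 < θ)
    (hθ' : θ < π) (t τ : ℝ) : ¬∀ r, 0 < r → r < R → φ r t = φ (R - r) τ := by
  intro H
  have hR := h.pos h₀
  have hm := (half_mem_lens hR).1
  have hm0 := ofReal_mem_halfDisk.1 hm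
  obtain ⟨A, u, v, hu, hA, hAm, hev⟩ := (h.locIsoAt t hm).exists_transition (h.locIsoAt τ hm) (by
    rw [sectorMap_ofReal _ _ hm0.1.le, sectorMap_ofReal _ _ hm0.1.le, H _ hm0.1 hm0.2]
    congr 1
    ring)
  have hAr : ∀ x : ℝ, A x = v + u * x := by
    rcases hA with rfl | rfl <;> intro x <;> simp
  have hinj := (h.locIsoAt τ hm).eventually_eq (x := R / 2) (k := fun x : ℝ => A x)
    (l := fun x : ℝ => (R : ℂ) - x) (A.continuous.comp Complex.continuous_ofReal).continuousAt
    (by fun_prop) hAm (by push_cast; ring)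
  have hline : ∀ᶠ x : ℝ in nhds (R / 2), v + u * x = R - x := by
    have h1 := (Complex.continuous_ofReal.continuousAt (x := R / 2)).eventually hev
    filter_upwards [h1, hinj, Ioo_mem_nhds hm0.1 hm0.2] with x h1 h2 hx
    rw [← hAr]
    apply h2
    have hx' : ((R : ℂ) - x) = ((R - x : ℝ) : ℂ) := by push_cast; ring
    rw [← h1, hx', sectorMap_ofReal _ _ hx.1.le, sectorMap_ofReal _ _ (by linarith [hx.2]),
      H x hx.1 hx.2]
  have hm1 := hline.self_of_nhds
  obtain ⟨x, hx, hxm⟩ : ∃ x : ℝ, v + u * x = R - x ∧ x ≠ R / 2 := by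
    have : ∃ᶠ x in nhds (R / 2), x ≠ R / 2 :=
      mem_closure_iff_frequently.1 (dense_compl_singleton (R / 2) (R / 2))
    obtain ⟨x, h1, h2⟩ := (this.and_eventually hline).exists
    exact ⟨x, h2, h1⟩
  have hu1 : u = -1 := by
    have hne : ((x - R / 2 : ℝ) : ℂ) ≠ 0 := by exact_mod_cast sub_ne_zero.2 hxm
    refine mul_right_cancel₀ hne ?_
    push_cast at hm1 ⊢
    linear_combination hx - hm1
  have hv : v = R := by
    rw [hu1] at hm1
    linear_combination hm1
  have hcont : ∀ B : ℂ ≃ᵢ ℂ, A = B → (∀ z ∈ lens R, B z ∈ halfDisk R) →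
      ∀ z ∈ lens R, sectorMap φ t z = sectorMap φ τ (B z) := by
    rintro B rfl hB z hz
    exact (LocIsoAt.eqOn (convex_lens R).isPreconnected (fun z hz => h.locIsoAt t hz.1)
      (fun z hz => (h.locIsoAt τ (hB z hz)).comp_isometry) (half_mem_lens hR) hev z
      hz).self_of_nhds
  rcases hA with rfl | rfl
  · refine h.not_rotational_overlap h₀ hθ hθ' t τ fun z hz => ?_
    have hB : ∀ z, directIso u v hu z = R - z := fun z => by
      rw [directIso_apply, hu1, hv]; ring
    rw [hcont _ rfl (fun z hz => by rw [hB]; exact hz.2) z hz, hB]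
  · refine h.not_reversing_overlap h₀ hθ hθ' t τ fun z hz => ?_
    have hB : ∀ z, reversingIso u v hu z = R - (starRingEnd ℂ) z := fun z => by
      rw [reversingIso_apply, hu1, hv]; ring
    rw [hcont _ rfl (fun z hz => by rw [hB]; exact sub_conj_mem_halfDisk hz) z hz, hB]

/-- No ray issued from the cone point comes back to it at distance `R`. -/
theorem not_dist_center_le (h : IsExpMap ε φ₀ R φ) (h₀ : IsPolarChart θ s ε φ₀) (hθ : 0 < θ)
    (hθ' : θ < π) (t : ℝ) : ¬∀ r, 0 < r → r < R → dist (φ r t) s ≤ R - r := by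
  intro H
  have hR := h.pos h₀
  have hε := h₀.pos
  have hεR := h.le
  set r₀ := R - ε / 2 with hr₀
  have hr₀0 : 0 < r₀ := by linarith
  have hr₀R : r₀ < R := by linarith
  have hH₀ := H r₀ hr₀0 hr₀R
  obtain ⟨ρ, τ, hρ, hρε, hφ⟩ := h₀.surj (φ r₀ t) (by rw [mem_ball]; linarith)
  rw [← hφ, h₀.dist_center hθ hθ' hρ hρε] at hH₀
  have hρ0 : 0 < ρ := by
    refine hρ.lt_of_ne' fun h0 => ?_
    rw [h0, h₀.zero] at hφ
    exact h.ne_center h₀ hθ hθ' hr₀0 hr₀R t hφ.symm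
  have hgeo : ∀ x ∈ Ioo 0 R, IsLocalGeodesicAt (fun x : ℝ => sectorMap φ t x) x := fun x hx =>
    (h.locIsoAt_ofReal t x hx.1 hx.2).isLocalGeodesicAt
  have hc : ∀ x ∈ Ioo 0 R, sectorMap φ t x = φ x t := fun x hx => sectorMap_ofReal _ _ hx.1.le
  rcases h.radial_or_line (convex_Ioo 0 R) hgeo (x₀ := r₀) ⟨hr₀0, hr₀R⟩ hρ0 (by linarith)
    (t₀ := τ) (by rw [hc r₀ ⟨hr₀0, hr₀R⟩, h.eq_chart ρ τ hρ hρε, hφ]) with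
    ⟨σ, hσ | hσ, hl⟩ | ⟨a, t', σ, x₁, hσ, ha, haρ, hsum, hl⟩
  · set x := max r₀ (R - ρ / 2) with hx
    have h1 : r₀ ≤ x := le_max_left _ _
    have h2 : R - ρ / 2 ≤ x := le_max_right _ _
    have h3 : x < R := max_lt hr₀R (by linarith)
    have h4 := hl x ⟨by linarith, h3⟩ (by rw [hσ]; linarith) (by rw [hσ]; linarith)
    have h5 := H x (by linarith) h3
    rw [hc x ⟨by linarith, h3⟩] at h4
    rw [h4, hσ, h.eq_chart _ _ (by linarith) (by linarith),
      h₀.dist_center hθ hθ' (by linarith) (by linarith)] at h5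
    linarith
  · have hle : ρ + r₀ = R := by
      refine le_antisymm (by linarith) (not_lt.1 fun hlt => ?_)
      have hmem : ρ + r₀ ∈ Ioo 0 R := ⟨by linarith, hlt⟩
      refine h.ne_center h₀ hθ hθ' hmem.1 hmem.2 t (dist_le_zero.1 (le_of_forall_pos_le_add
        fun η hη => ?_))
      set y := max r₀ (ρ + r₀ - η / 2) with hy
      have h1 : r₀ ≤ y := le_max_left _ _
      have h2 : ρ + r₀ - η / 2 ≤ y := le_max_right _ _
      have h3 : y < ρ + r₀ := max_lt (by linarith) (by linarith)
      have h4 := hl y ⟨by linarith, by linarith⟩ (by rw [hσ]; linarith) (by rw [hσ]; linarith)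
      rw [hc y ⟨by linarith, by linarith⟩] at h4
      have h5 := h₀.dist_center hθ hθ' (r := ρ + σ * (y - r₀)) (t := τ) (by rw [hσ]; linarith)
        (by rw [hσ]; linarith)
      rw [← h.eq_chart _ _ (by rw [hσ]; linarith) (by rw [hσ]; linarith), ← h4, hσ] at h5
      have h6 := h.dist_le hmem.1 hmem.2 (by linarith : 0 < y) (by linarith) t
      rw [abs_of_pos (by linarith)] at h6
      linarith [dist_triangle (φ (ρ + r₀) t) (φ y t) s]
    refine h.not_ray_eq_reversed_ray h₀ hθ hθ' t τ fun r hr hrR => ?_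
    have h1 : ρ + σ * (r - r₀) = R - r := by rw [hσ]; linarith
    have h2 := hl r ⟨hr, hrR⟩ (by rw [h1]; linarith) (by rw [h1]; linarith)
    rwa [hc r ⟨hr, hrR⟩, h1] at h2
  · have hx₁ : |r₀ - x₁| < ρ := abs_lt_of_sq_lt_sq (by nlinarith) hρ
    set x := max r₀ (R - a / 2) with hx
    have h1 : r₀ ≤ x := le_max_left _ _
    have h2 : R - a / 2 ≤ x := le_max_right _ _
    have h3 : x < R := max_lt hr₀R (by linarith)
    have h5 := H x (by linarith) h3
    have h6 : a ^ 2 + (x - x₁) ^ 2 < ε ^ 2 := by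
      rw [abs_lt] at hx₁
      have h7 : (x - x₁) ^ 2 = (r₀ - x₁) ^ 2 + 2 * (x - r₀) * (r₀ - x₁) + (x - r₀) ^ 2 := by ring
      have h8 : 0 ≤ x - r₀ := by linarith
      have h9 : x - r₀ < ε / 2 := by linarith
      have h10 : (x - r₀) * (r₀ - x₁) ≤ (ε / 2) * (ε / 2) := by
        nlinarith
      nlinarith
    have h4 := hl x ⟨by linarith, h3⟩ (by nlinarith)
    rw [hc x ⟨by linarith, h3⟩] at h4
    have hσ2 : σ ^ 2 = 1 := by rcases hσ with rfl | rfl <;> norm_num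
    have h7 : ‖(⟨a, σ * (x - x₁)⟩ : ℂ)‖ < ε := by
      refine lt_of_pow_lt_pow_left₀ 2 hε.le ?_
      rw [sq_norm_mk, mul_pow, hσ2, one_mul]
      exact h6
    have h8 : a ≤ ‖(⟨a, σ * (x - x₁)⟩ : ℂ)‖ :=
      (le_abs_self a).trans (Complex.abs_re_le_norm (⟨a, σ * (x - x₁)⟩ : ℂ))
    rw [h4, sectorMap, h.eq_chart _ _ (norm_nonneg _) h7,
      h₀.dist_center hθ hθ' (norm_nonneg _) h7] at h5
    linarith

/-- Outside a small ball, the image of an exponential map stays away from the cone point. -/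
theorem exists_le_dist_center (h : IsExpMap ε φ₀ R φ) (h₀ : IsPolarChart θ s ε φ₀) (hθ : 0 < θ)
    (hθ' : θ < π) : ∃ κ > 0, ∀ r t, ε / 2 ≤ r → r < R → κ ≤ dist (φ r t) s := by
  have hε := h₀.pos
  have hεR := h.le
  by_contra! H
  choose r t hr hrR hd using fun n : ℕ => H (1 / (n + 1 : ℝ)) (by positivity)
  choose t' ht' htφ using fun n => h.exists_mem_Ico h₀ hθ hθ' (t n)
  have hcpt : IsCompact (Icc (ε / 2) R ×ˢ Icc 0 θ) := isCompact_Icc.prod isCompact_Icc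
  obtain ⟨⟨r', t''⟩, ⟨hr'm, -⟩, ψ, hψ, hlim⟩ := hcpt.tendsto_subseq
    (x := fun n => (r n, t' n)) fun n => ⟨⟨hr n, (hrR n).le⟩, ⟨(ht' n).1, (ht' n).2.le⟩⟩
  simp only [mem_Icc] at hr'm
  have hlimr : Filter.Tendsto (fun n => r (ψ n)) Filter.atTop (nhds r') :=
    (continuous_fst.tendsto _).comp hlim
  have hlimt : Filter.Tendsto (fun n => t' (ψ n)) Filter.atTop (nhds t'') :=
    (continuous_snd.tendsto _).comp hlim
  have hlimd : Filter.Tendsto (fun n => 1 / ((ψ n : ℝ) + 1)) Filter.atTop (nhds 0) :=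
    tendsto_one_div_add_atTop_nhds_zero_nat.comp hψ.tendsto_atTop
  have key : ∀ x, 0 < x → x < R → dist (φ x t'') s ≤ |x - r'| := by
    intro x hx hxR
    have h1 : Filter.Tendsto (fun n => dist (φ x (t' (ψ n))) s) Filter.atTop
        (nhds (dist (φ x t'') s)) := by
      have h2 : ContinuousAt (fun p : ℝ × ℝ => φ p.1 p.2) (x, t'') := h.continuousAt hx hxR
      have h3 : Filter.Tendsto (fun n => (x, t' (ψ n))) Filter.atTop (nhds (x, t'')) :=
        tendsto_const_nhds.prodMk_nhds hlimt
      exact (h2.tendsto.comp h3).dist tendsto_const_nhds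
    have h4 : Filter.Tendsto (fun n => |x - r (ψ n)| + 1 / ((ψ n : ℝ) + 1)) Filter.atTop
        (nhds (|x - r'| + 0)) := ((tendsto_const_nhds.sub hlimr).abs).add hlimd
    rw [add_zero] at h4
    refine le_of_tendsto_of_tendsto' h1 h4 fun n => ?_
    have hrn : 0 < r (ψ n) := by linarith [hr (ψ n)]
    have h5 := h.dist_le hx hxR hrn (hrR _) (t' (ψ n))
    have h6 := hd (ψ n)
    rw [htφ _ _ hrn.le (hrR _)] at h6
    linarith [dist_triangle (φ x (t' (ψ n))) (φ (r (ψ n)) (t' (ψ n))) s]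
  rcases hr'm.2.lt_or_eq with hlt | rfl
  · have h1 := key r' (by linarith [hr'm.1]) hlt
    rw [sub_self, abs_zero] at h1
    exact h.ne_center h₀ hθ hθ' (by linarith [hr'm.1]) hlt t'' (dist_le_zero.1 h1)
  · refine h.not_dist_center_le h₀ hθ hθ' t'' fun x hx hxR => ?_
    have := key x hx hxR
    rwa [abs_sub_comm, abs_of_pos (by linarith)] at this

end IsExpMap

end NonReturn

section FlatDisks

variable {S : Type*} [MetricSpace S]

/-- The ball of radius `ρ` around `x` is a flat disk. -/
def HasFlatDisk (x : S) (ρ : ℝ) : Prop := ∃ D : ℂ → S, D 0 = x ∧ IsDiskIso D 0 ρ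

theorem HasFlatDisk.mono {x y : S} {ρ ρ' : ℝ} (h : HasFlatDisk x ρ) (hρ' : 0 < ρ')
    (hd : dist y x + ρ' ≤ ρ) : HasFlatDisk y ρ' := by
  obtain ⟨D, rfl, hD⟩ := h
  have hρ : 0 < ρ := by linarith [dist_nonneg (x := y) (y := D 0)]
  obtain ⟨a, ha, rfl⟩ := hD.2 y (by rw [mem_ball]; linarith)
  rw [hD.1 a ha 0 (mem_ball_self hρ)] at hd
  have hA : directIso 1 a norm_one 0 = a := by simp
  refine ⟨fun z => D (directIso 1 a norm_one z), by simp, IsDiskIso.comp_isometry _ ?_⟩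
  rw [hA]
  exact hD.mono hρ' hd

theorem IsRegularPoint.exists_hasFlatDisk {x : S} (h : IsRegularPoint x) :
    ∃ ρ > 0, HasFlatDisk x ρ := by
  obtain ⟨ρ, hρ, f, hf, himg⟩ := h
  set L := Complex.orthonormalBasisOneI.repr with hL
  have hex : ∀ z : ℂ, ∃ q, z ∈ ball (0 : ℂ) ρ → q ∈ ball x ρ ∧ f q = f x + L z := by
    intro z
    by_cases hz : z ∈ ball (0 : ℂ) ρ
    · have : f x + L z ∈ f '' ball x ρ := by
        rw [himg, mem_ball, dist_eq_norm, add_sub_cancel_left, L.norm_map]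
        simpa using hz
      obtain ⟨q, hq, hq'⟩ := this
      exact ⟨q, fun _ => ⟨hq, hq'⟩⟩
    · exact ⟨x, fun h => absurd h hz⟩
  choose D hD using hex
  have h0 : D 0 = x := by
    obtain ⟨h1, h2⟩ := hD 0 (mem_ball_self hρ)
    rw [← dist_eq_zero, ← hf _ h1 _ (mem_ball_self hρ), h2]
    simp
  refine ⟨ρ, hρ, D, h0, fun a ha b hb => ?_, fun p hp => ?_⟩
  · rw [← hf _ (hD a ha).1 _ (hD b hb).1, (hD a ha).2, (hD b hb).2, dist_add_left, L.dist_map]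
  · rw [h0] at hp
    have hn : L.symm (f p - f x) ∈ ball (0 : ℂ) ρ := by
      rw [mem_ball_zero_iff, L.symm.norm_map, ← dist_eq_norm, hf p hp x (mem_ball_self hρ)]
      exact hp
    refine ⟨_, hn, ?_⟩
    rw [← dist_eq_zero, ← hf _ (hD _ hn).1 _ hp, (hD _ hn).2]
    simp

theorem ESCS.exists_uniform_hasFlatDisk [CompactSpace S] (E : ESCS S) {κ : ℝ} (hκ : 0 < κ) :
    ∃ ρ > 0, ∀ x, (∀ c ∈ E.conePts, κ ≤ dist x c) → HasFlatDisk x ρ := by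
  have hK : IsCompact {x : S | ∀ c ∈ E.conePts, κ ≤ dist x c} := by
    refine IsClosed.isCompact ?_
    have : {x : S | ∀ c ∈ E.conePts, κ ≤ dist x c} = ⋂ c ∈ E.conePts, {x | κ ≤ dist x c} := by
      ext x; simp
    rw [this]
    exact isClosed_biInter fun c _ => isClosed_le continuous_const (by fun_prop)
  refine hK.induction_on (p := fun K => ∃ ρ > 0, ∀ x ∈ K, HasFlatDisk x ρ) ⟨1, one_pos, by simp⟩
    ?_ ?_ ?_
  · rintro K K' hKK ⟨ρ, hρ, h⟩
    exact ⟨ρ, hρ, fun x hx => h x (hKK hx)⟩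
  · rintro K K' ⟨ρ, hρ, h⟩ ⟨ρ', hρ', h'⟩
    refine ⟨min ρ ρ', lt_min hρ hρ', fun x hx => ?_⟩
    rcases hx with hx | hx
    · exact (h x hx).mono (lt_min hρ hρ') (by simp)
    · exact (h' x hx).mono (lt_min hρ hρ') (by simp)
  · intro x hx
    have hxc : x ∉ E.conePts := fun hc => by
      have := hx x hc
      rw [dist_self] at this
      linarith
    obtain ⟨ρ, hρ, h⟩ := (E.regular x hxc).exists_hasFlatDisk
    refine ⟨ball x (ρ / 2), mem_nhdsWithin_of_mem_nhds (ball_mem_nhds x (half_pos hρ)), ρ / 2,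
      half_pos hρ, fun y hy => h.mono (half_pos hρ) ?_⟩
    rw [mem_ball] at hy
    linarith

/-- A local isometry of the plane extends to any flat disk. -/
theorem LocIsoAt.exists_isDiskIso {F : ℂ → S} {z : ℂ} (h : LocIsoAt F z) {ρ : ℝ} (hρ : 0 < ρ)
    (hx : HasFlatDisk (F z) ρ) : ∃ G : ℂ → S, IsDiskIso G z ρ ∧ G =ᶠ[nhds z] F := by
  obtain ⟨D, hD0, hD⟩ := hx
  obtain ⟨A, -, -, -, -, hA, hev⟩ :=
    h.exists_transition (hD.locIsoAt (mem_ball_self hρ)) hD0.symm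
  refine ⟨fun x => D (A x), IsDiskIso.comp_isometry _ (by rwa [hA]), hev.symm⟩

end FlatDisks

section Extension

variable {S : Type*} [MetricSpace S] {θ : ℝ} {s : S} {ε R : ℝ} {φ₀ φ : ℝ → ℝ → S}

namespace IsExpMap

theorem exists_extension (h : IsExpMap ε φ₀ R φ) (h₀ : IsPolarChart θ s ε φ₀) {ρ : ℝ} (hρ : 0 < ρ)
    (hflat : ∀ r t, ε / 2 ≤ r → r < R → HasFlatDisk (φ r t) ρ) :
    ∃ R' > R, ∃ ψ, IsExpMap ε φ₀ R' ψ := by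
  have hε := h₀.pos
  have hεR := h.le
  have hR := h.pos h₀
  set η := min ρ ε / 4 with hη
  have hη0 : 0 < η := by have := lt_min hρ hε; positivity
  have hηρ : η ≤ ρ / 4 := by rw [hη]; linarith [min_le_left ρ ε]
  have hηε : η ≤ ε / 4 := by rw [hη]; linarith [min_le_right ρ ε]
  set r₁ := R - η with hr₁
  have hr₁0 : 0 < r₁ := by linarith
  have hr₁R : r₁ < R := by linarith
  have hr₁H : (r₁ : ℂ) ∈ halfDisk R := ofReal_mem_halfDisk.2 ⟨hr₁0, hr₁R⟩
  have hex : ∀ t, ∃ G : ℂ → S, IsDiskIso G r₁ ρ ∧ G =ᶠ[nhds (r₁ : ℂ)] sectorMap φ t := fun t =>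
    (h.locIsoAt t hr₁H).exists_isDiskIso hρ (by
      rw [sectorMap_ofReal _ _ hr₁0.le]
      exact hflat _ _ (by linarith) hr₁R)
  choose G hG hGF using hex
  have hGloc : ∀ t, ∀ z ∈ ball (r₁ : ℂ) ρ, LocIsoAt (G t) z := fun t z hz => (hG t).locIsoAt hz
  have hGeq : ∀ t, ∀ z ∈ ball (r₁ : ℂ) ρ ∩ halfDisk R, G t =ᶠ[nhds z] sectorMap φ t := fun t =>
    LocIsoAt.eqOn ((convex_ball _ _).inter (convex_halfDisk R)).isPreconnected
      (fun z hz => hGloc t z hz.1) (fun z hz => h.locIsoAt t hz.2)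
      ⟨mem_ball_self hρ, hr₁H⟩ (hGF t)
  have hGrot : ∀ t α : ℝ, |α| < π / 2 → (r₁ : ℂ) * Complex.exp (α * Complex.I) ∈ ball (r₁ : ℂ) ρ →
      ∀ y ∈ ball (r₁ : ℂ) ρ, y * Complex.exp (α * Complex.I) ∈ ball (r₁ : ℂ) ρ →
        G (t + α) y = G t (y * Complex.exp (α * Complex.I)) := by
    intro t α hα hb y hy hy'
    have hu : ‖Complex.exp (α * Complex.I)‖ = 1 := Complex.norm_exp_ofReal_mul_I _
    set A := directIso _ 0 hu with hA
    have hAx : ∀ x, A x = x * Complex.exp (α * Complex.I) := fun x => by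
      rw [hA, directIso_apply]; ring
    have hconv : Convex ℝ {x : ℂ | x * Complex.exp (α * Complex.I) ∈ ball (r₁ : ℂ) ρ} := by
      intro a ha b hb x y hx hy hxy
      have := convex_ball (r₁ : ℂ) ρ ha hb hx hy hxy
      show (x • a + y • b) * Complex.exp (α * Complex.I) ∈ ball (r₁ : ℂ) ρ
      convert this using 1
      simp only [Complex.real_smul]
      ring
    have hbase : G (t + α) =ᶠ[nhds (r₁ : ℂ)] fun x => G t (A x) := by
      have h1 := hGeq t (A r₁) ⟨by rwa [hAx], by
        rw [hAx]; exact ofReal_mul_exp_mem_halfDisk hr₁0 hr₁R hα⟩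
      filter_upwards [hGF (t + α), A.continuous.continuousAt.eventually h1,
        (isOpen_halfDisk R).mem_nhds hr₁H] with x h2 h3 h4
      rw [h2, h3, hAx, sectorMap_mul_exp _ _ h4.1 hα.le]
    have := (LocIsoAt.eqOn ((convex_ball (r₁ : ℂ) ρ).inter hconv).isPreconnected
      (fun z hz => hGloc (t + α) z hz.1)
      (fun z hz => (hGloc t (A z) (by rw [hAx]; exact hz.2)).comp_isometry)
      ⟨mem_ball_self hρ, hb⟩ hbase y ⟨hy, hy'⟩).self_of_nhds
    simpa only [hAx] using this
  refine ⟨r₁ + ρ, by linarith, fun r t => if r < R then φ r t else G t r, by linarith,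
    fun t r hr hrR => ?_, fun r t hr hrε => ?_⟩
  · by_cases hlt : r < R
    · have hmem : (r : ℂ) ∈ halfDisk R := ofReal_mem_halfDisk.2 ⟨hr, hlt⟩
      refine (h.locIsoAt t hmem).congr ?_
      filter_upwards [(isOpen_halfDisk R).mem_nhds hmem] with z hz
      simp only [sectorMap, if_pos hz.2]
    · have hrb : (r : ℂ) ∈ ball (r₁ : ℂ) ρ := by
        rw [mem_ball, Complex.dist_of_im_eq (by simp), Complex.ofReal_re, Complex.ofReal_re,
          Real.dist_eq, abs_lt]
        constructor <;> linarith
      refine (hGloc t r hrb).congr ?_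
      have harg : ContinuousAt Complex.arg (r : ℂ) :=
        Complex.continuousAt_arg (Complex.ofReal_mem_slitPlane.2 hr)
      have harg0 : (r : ℂ).arg = 0 := Complex.arg_ofReal_of_nonneg hr.le
      have h1 : ∀ᶠ z : ℂ in nhds (r : ℂ), 0 < z.re :=
        continuousAt_const.eventually_lt Complex.continuous_re.continuousAt (by simpa using hr)
      have h2 : ∀ᶠ z : ℂ in nhds (r : ℂ),
          (r₁ : ℂ) * Complex.exp (z.arg * Complex.I) ∈ ball (r₁ : ℂ) ρ := by
        have hc : Continuous fun x : ℝ => (r₁ : ℂ) * Complex.exp (x * Complex.I) := by fun_prop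
        refine (hc.continuousAt.comp harg).eventually (isOpen_ball.mem_nhds ?_)
        simp [harg0, hρ]
      have h3 : ∀ᶠ z : ℂ in nhds (r : ℂ), ((‖z‖ : ℝ) : ℂ) ∈ ball (r₁ : ℂ) ρ := by
        have hc : Continuous fun z : ℂ => ((‖z‖ : ℝ) : ℂ) := by fun_prop
        refine hc.continuousAt.eventually (isOpen_ball.mem_nhds ?_)
        simpa [abs_of_pos hr] using hrb
      filter_upwards [h1, h2, h3, isOpen_ball.mem_nhds hrb] with z h1 h2 h3 h4
      by_cases hz : ‖z‖ < R
      · simp only [(hGeq t z ⟨h4, h1, hz⟩).self_of_nhds, sectorMap, if_pos hz]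
      · have hz' : ((‖z‖ : ℝ) : ℂ) * Complex.exp (z.arg * Complex.I) = z :=
          Complex.norm_mul_exp_arg_mul_I z
        simp only [sectorMap, if_neg hz]
        rw [hGrot t z.arg (Complex.abs_arg_lt_pi_div_two_iff.2 (Or.inl h1)) h2 _ h3
          (by rwa [hz']), hz']
  · rw [if_pos (hrε.trans_le hεR), h.eq_chart r t hr hrε]

end IsExpMap

theorem ESCS.exists_isExpMap [CompactSpace S] (E : ESCS S) (h₀ : IsPolarChart θ s ε φ₀)
    (hθ : 0 < θ) (hθ' : θ < π) {C : ℝ} (hεC : ε ≤ C)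
    (hC : ∀ s' ∈ E.conePts, s' ≠ s → C < dist s s') : ∃ φ, IsExpMap ε φ₀ C φ := by
  set T : Set ℝ := {R | R ≤ C ∧ ∃ φ, IsExpMap ε φ₀ R φ} with hT
  have hεT : ε ∈ T := ⟨hεC, φ₀, h₀.isExpMap hθ hθ'⟩
  have hbdd : BddAbove T := ⟨C, fun R hR => hR.1⟩
  set R := sSup T with hR
  have hRC : R ≤ C := csSup_le ⟨ε, hεT⟩ fun R hR => hR.1
  have hεR : ε ≤ R := le_csSup hbdd hεT
  have hex : ∀ r, ∃ (R' : ℝ) (ψ : ℝ → ℝ → S), r < R → r < R' ∧ R' ≤ R ∧ IsExpMap ε φ₀ R' ψ := by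
    intro r
    by_cases hr : r < R
    · obtain ⟨R', hR', hlt⟩ := exists_lt_of_lt_csSup ⟨ε, hεT⟩ hr
      obtain ⟨-, ψ, hψ⟩ := id hR'
      exact ⟨R', ψ, fun _ => ⟨hlt, le_csSup hbdd hR', hψ⟩⟩
    · exact ⟨0, φ₀, fun h => absurd h hr⟩
  choose R' ψ hψ using hex
  have heq : ∀ r, r < R → ∀ r', 0 ≤ r' → r' < R' r → ∀ t, ψ r' r' t = ψ r r' t := by
    intro r hr r' hr' hlt t
    obtain ⟨h1, h2, h3⟩ := hψ r hr
    obtain ⟨h4, h5, h6⟩ := hψ r' (hlt.trans_le h2)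
    exact (h6.mono (le_min h6.le h3.le) (min_le_left _ _)).eq h₀
      (h3.mono (le_min h6.le h3.le) (min_le_right _ _)) hr' (lt_min h4 hlt) t
  have hexp : IsExpMap ε φ₀ R fun r t => ψ r r t := by
    refine ⟨hεR, fun t r hr hrR => ?_, fun r t hr hrε => ?_⟩
    · obtain ⟨h1, h2, h3⟩ := hψ r hrR
      exact (h3.congr (ψ := fun r t => ψ r r t) fun r' t hr' hlt =>
        heq r hrR r' hr' hlt t).locIsoAt_ofReal t r hr h1
    · exact (hψ r (hrε.trans_le hεR)).2.2.eq_chart r t hr hrε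
  rcases hRC.lt_or_eq with hlt | heq
  · obtain ⟨κ, hκ, hκd⟩ := hexp.exists_le_dist_center h₀ hθ hθ'
    obtain ⟨ρ, hρ, hflat⟩ := E.exists_uniform_hasFlatDisk (lt_min hκ (sub_pos.2 hlt))
    obtain ⟨R'', hR'', χ, hχ⟩ := hexp.exists_extension h₀ hρ fun r t hr hrR => by
      refine hflat _ fun c hc => ?_
      by_cases hcs : c = s
      · rw [hcs]
        exact (min_le_left _ _).trans (hκd r t hr hrR)
      · have h1 := hexp.dist_center_le h₀ hθ hθ' (by linarith [h₀.pos]) hrR t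
        have h2 := dist_triangle_left s c (ψ r r t)
        have h3 := hC c hc hcs
        refine (min_le_right _ _).trans ?_
        linarith
    have hmem : min R'' C ∈ T := ⟨min_le_right _ _, χ, hχ.mono (le_min hχ.le hεC) (min_le_left _ _)⟩
    exact absurd (le_csSup hbdd hmem) (not_le.2 (lt_min hR'' hlt))
  · exact ⟨_, heq ▸ hexp⟩

end Extension

namespace IsExpMap

variable {S : Type*} [MetricSpace S] {θ : ℝ} {s : S} {ε R : ℝ} {φ₀ φ : ℝ → ℝ → S}

theorem continuousOn (h : IsExpMap ε φ₀ R φ) (h₀ : IsPolarChart θ s ε φ₀) (hθ : 0 < θ)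
    (hθ' : θ < π) : ContinuousOn (fun p : ℝ × ℝ => φ p.1 p.2) (Ico 0 R ×ˢ univ) := by
  rintro p ⟨⟨hp, hpR⟩, -⟩
  obtain hp | hp := hp.lt_or_eq
  · exact (h.continuousAt hp hpR).continuousWithinAt
  · have hs : φ p.1 p.2 = s := by rw [← hp, h.zero h₀]
    rw [ContinuousWithinAt, hs, tendsto_iff_dist_tendsto_zero]
    refine squeeze_zero' (Filter.Eventually.of_forall fun _ => dist_nonneg)
      (eventually_nhdsWithin_of_forall fun q hq =>
        h.dist_center_le h₀ hθ hθ' hq.1.1 hq.1.2 q.2) ?_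
    have : Filter.Tendsto (fun q : ℝ × ℝ => q.1) (nhds p) (nhds p.1) := continuousAt_fst
    rw [← hp] at this
    exact this.mono_left nhdsWithin_le_nhds

theorem exists_eq_of_path (h : IsExpMap ε φ₀ R φ) (h₀ : IsPolarChart θ s ε φ₀) (hθ : 0 < θ)
    (hθ' : θ < π) {f : ℝ → S} (hf : Continuous f) (hfs : f 0 = s)
    (hfR : eVariationOn f (Icc 0 1) < ENNReal.ofReal R) :
    ∃ r t, 0 ≤ r ∧ ENNReal.ofReal r ≤ eVariationOn f (Icc 0 1) ∧ φ r t = f 1 := by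
  set T : Set ℝ := {u | u ∈ Icc (0 : ℝ) 1 ∧
    ∃ r t, 0 ≤ r ∧ ENNReal.ofReal r ≤ eVariationOn f (Icc 0 u) ∧ φ r t = f u} with hT
  have hR := h.pos h₀
  set V := eVariationOn f (Icc 0 1) with hV
  have hVtop : V ≠ ⊤ := ne_top_of_lt hfR
  have hVR : V.toReal < R := by
    rwa [← ENNReal.ofReal_lt_ofReal_iff hR, ENNReal.ofReal_toReal hVtop]
  have hle : ∀ u ∈ Icc (0 : ℝ) 1, ∀ r, ENNReal.ofReal r ≤ eVariationOn f (Icc 0 u) →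
      r ≤ V.toReal := fun u hu r hr => by
    rw [← ENNReal.ofReal_le_iff_le_toReal hVtop]
    exact hr.trans (eVariationOn.mono f (Icc_subset_Icc_right hu.2))
  have h0T : (0 : ℝ) ∈ T :=
    ⟨left_mem_Icc.2 zero_le_one, 0, 0, le_rfl, by simp, by rw [h.zero h₀, hfs]⟩
  have hbdd : BddAbove T := ⟨1, fun u hu => hu.1.2⟩
  set c := sSup T with hc
  have hc0 : 0 ≤ c := le_csSup hbdd h0T
  have hc1 : c ≤ 1 := csSup_le ⟨0, h0T⟩ fun u hu => hu.1.2
  have hcT : c ∈ T := by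
    obtain ⟨u, -, hu, huT⟩ := exists_seq_tendsto_sSup ⟨0, h0T⟩ hbdd
    have hp : ∀ n, ∃ p : ℝ × ℝ, p ∈ Icc 0 V.toReal ×ˢ Icc 0 θ ∧
        ENNReal.ofReal p.1 ≤ eVariationOn f (Icc 0 (u n)) ∧ φ p.1 p.2 = f (u n) := by
      intro n
      obtain ⟨hun, r, t, hr, hrV, hrt⟩ := huT n
      obtain ⟨t', ht', heq⟩ := h.exists_mem_Ico h₀ hθ hθ' t
      have hrV' := hle _ hun r hrV
      exact ⟨(r, t'), ⟨⟨hr, hrV'⟩, Ico_subset_Icc_self ht'⟩, hrV,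
        by rw [← hrt, heq r hr (hrV'.trans_lt hVR)]⟩
    choose p hpK hpV hpu using hp
    obtain ⟨q, hqK, k, hk, hkq⟩ := (isCompact_Icc.prod isCompact_Icc).tendsto_subseq hpK
    have hlim : Filter.Tendsto (fun n => φ (p (k n)).1 (p (k n)).2) Filter.atTop
        (nhds (φ q.1 q.2)) := by
      refine (h.continuousOn h₀ hθ hθ' q ⟨⟨hqK.1.1, hqK.1.2.trans_lt hVR⟩, mem_univ _⟩).tendsto.comp
        (tendsto_nhdsWithin_iff.2 ⟨hkq, Filter.Eventually.of_forall fun n => ?_⟩)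
      exact ⟨⟨(hpK _).1.1, (hpK _).1.2.trans_lt hVR⟩, mem_univ _⟩
    have hlim' : Filter.Tendsto (fun n => f (u (k n))) Filter.atTop (nhds (f c)) :=
      (hf.tendsto c).comp (hu.comp hk.tendsto_atTop)
    refine ⟨⟨hc0, hc1⟩, q.1, q.2, hqK.1.1, ?_, tendsto_nhds_unique hlim (by simpa only [hpu])⟩
    refine le_of_tendsto' (ENNReal.tendsto_ofReal ((continuous_fst.tendsto q).comp hkq))
      fun n => (hpV _).trans (eVariationOn.mono f (Icc_subset_Icc_right ?_))
    exact le_csSup hbdd (huT _)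
  obtain ⟨-, r, t, hr, hrV, hrt⟩ := hcT
  obtain hc1 | hc1 := hc1.eq_or_lt
  · rw [hc1] at hrV hrt
    exact ⟨r, t, hr, hrV, hrt⟩
  exfalso
  have hrR : r < R := (hle c ⟨hc0, hc1.le⟩ r hrV).trans_lt hVR
  obtain ⟨δ, hδ, hloc⟩ : ∃ δ > 0, ∀ y ∈ ball (f c) δ,
      ∃ r' t', 0 ≤ r' ∧ r' ≤ r + dist (f c) y ∧ φ r' t' = y := by
    obtain rfl | hr := hr.eq_or_lt
    · rw [h.zero h₀] at hrt
      refine ⟨ε, h₀.pos, fun y hy => ?_⟩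
      rw [← hrt] at hy ⊢
      obtain ⟨r', t', hr', hrε, rfl⟩ := h₀.surj y hy
      exact ⟨r', t', hr', by rw [dist_comm, h₀.dist_center hθ hθ' hr' hrε, zero_add],
        h.eq_chart r' t' hr' hrε⟩
    · obtain ⟨δ, hδ, hiso⟩ := h.locIsoAt_ofReal t r hr hrR
      rw [← hrt, ← sectorMap_ofReal φ t hr.le]
      refine ⟨δ, hδ, fun y hy => ?_⟩
      obtain ⟨a, ha, rfl⟩ := hiso.2 y hy
      refine ⟨‖a‖, t + a.arg, norm_nonneg _, ?_, rfl⟩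
      rw [hiso.1 _ (mem_ball_self hδ) _ ha, dist_eq_norm]
      have h1 := norm_sub_norm_le a (r : ℂ)
      rw [Complex.norm_of_nonneg hr.le, norm_sub_rev] at h1
      linarith
  have hev : ∀ᶠ v in nhdsWithin c (Ioi c), f v ∈ ball (f c) δ :=
    nhdsWithin_le_nhds (hf.continuousAt.eventually (ball_mem_nhds _ hδ))
  obtain ⟨v, hv, hcv⟩ := (hev.and (Ioc_mem_nhdsGT hc1)).exists
  obtain ⟨r', t', hr', hle', hrt'⟩ := hloc _ hv
  refine absurd (le_csSup hbdd (a := v) ⟨⟨hc0.trans hcv.1.le, hcv.2⟩, r', t', hr', ?_, hrt'⟩)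
    (not_le.2 hcv.1)
  have hadd := eVariationOn.Icc_add_Icc f (s := univ) hc0 hcv.1.le (mem_univ _)
  simp only [univ_inter] at hadd
  rw [← hadd]
  refine (ENNReal.ofReal_le_ofReal hle').trans ?_
  rw [ENNReal.ofReal_add hr dist_nonneg, ← edist_dist]
  exact add_le_add hrV
    (eVariationOn.edist_le f (left_mem_Icc.2 hcv.1.le) (right_mem_Icc.2 hcv.1.le))

theorem exists_eq_of_dist_lt (h : IsExpMap ε φ₀ R φ) (h₀ : IsPolarChart θ s ε φ₀) (hθ : 0 < θ)
    (hθ' : θ < π) (hS : IsLengthSpace S) {x : S} {ρ : ℝ} (hx : dist x s < ρ) (hρ : ρ ≤ R) :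
    ∃ r t, 0 ≤ r ∧ r < ρ ∧ φ r t = x := by
  have hρ0 : 0 < ρ := dist_nonneg.trans_lt hx
  have hlt : edist s x < ENNReal.ofReal ρ := by
    rw [edist_dist, dist_comm]
    exact (ENNReal.ofReal_lt_ofReal_iff hρ0).2 hx
  rw [hS s x, iInf_lt_iff] at hlt
  obtain ⟨γ, hγ⟩ := hlt
  have hle : eVariationOn γ.extend (Icc 0 1) ≤ pathLength γ :=
    eVariationOn.comp_le_of_monotoneOn (fun t => γ t) (projIcc 0 1 zero_le_one)
      ((monotone_projIcc _).monotoneOn _) (mapsTo_univ _ _)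
  obtain ⟨r, t, hr, hrV, hrt⟩ := h.exists_eq_of_path h₀ hθ hθ' γ.continuous_extend
    γ.extend_zero (hle.trans_lt (hγ.trans_le (ENNReal.ofReal_le_ofReal hρ)))
  exact ⟨r, t, hr, (ENNReal.ofReal_lt_ofReal_iff hρ0).1 (hrV.trans_lt (hle.trans_lt hγ)),
    by rw [hrt, γ.extend_one]⟩

end IsExpMap

section NullHomotopy

variable {X : Type*} [TopologicalSpace X]

/-- Under a map `Ψ : [0, ∞) × ℝ → X` collapsing `{0} × ℝ`, a path joining two points of the same
image ray is null-homotopic. -/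
theorem Path.homotopic_refl_of_eq_comp {x s : X} (γ : Path x x) (Ψ : C(ℝ × ℝ, X)) {r a b : ℝ}
    (hs : ∀ t, Ψ (0, t) = s) (hab : ∀ r, Ψ (r, a) = Ψ (r, b)) (p : Path (r, a) (r, b))
    (hγ : ∀ u, γ u = Ψ (p u)) : γ.Homotopic (Path.refl x) := by
  have hxa : x = Ψ (r, a) := by simpa using hγ 0
  have hxb : x = Ψ (r, b) := by simpa using hγ 1
  let σ : Path ((r, a) : ℝ × ℝ) (0, a) :=
    { toFun := fun u => ((1 - u) * r, a)
      continuous_toFun := by fun_prop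
      source' := by simp
      target' := by simp }
  let τ : Path ((0, a) : ℝ × ℝ) (0, b) :=
    { toFun := fun u => (0, (1 - u) * a + u * b)
      continuous_toFun := by fun_prop
      source' := by simp
      target' := by simp }
  let σ' : Path ((0, b) : ℝ × ℝ) (r, b) :=
    { toFun := fun u => (u * r, b)
      continuous_toFun := by fun_prop
      source' := by simp
      target' := by simp }
  have hp : p.Homotopic ((σ.trans τ).trans σ') := SimplyConnectedSpace.paths_homotopic _ _
  let δ : Path x s := (σ.map Ψ.continuous).cast hxa (hs a).symm
  have h1 : γ = (p.map Ψ.continuous).cast hxa hxb := by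
    ext u
    exact hγ u
  have h2 : (((σ.trans τ).trans σ').map Ψ.continuous).cast hxa hxb =
      (δ.trans (Path.refl s)).trans δ.symm := by
    ext u
    simp only [Path.cast_coe, Path.map_coe, Function.comp_apply, Path.trans_apply]
    split_ifs
    · rfl
    · exact hs _
    · simp only [δ, σ, σ', Path.symm_apply, Path.cast_coe, Path.map_coe, Function.comp_apply,
        Path.coe_mk_mk, unitInterval.coe_symm_eq, sub_sub_cancel]
      exact (hab _).symm
  rw [h1]
  refine ((hp.map Ψ).pathCast hxa hxb).trans ?_
  rw [h2]
  refine (Path.Homotopic.hcomp ⟨Path.Homotopy.transRefl δ⟩ (.refl _)).trans ?_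
  exact ⟨(Path.Homotopy.reflTransSymm δ).symm⟩

end NullHomotopy

section Main

variable {S : Type*} [MetricSpace S] {θ : ℝ} {s : S} {ε R : ℝ} {φ₀ φ : ℝ → ℝ → S}

theorem Complex.mk_mul_tan_eq {a α : ℝ} (hα : Real.cos α ≠ 0) :
    (⟨a, a * Real.tan α⟩ : ℂ) = ((a / Real.cos α : ℝ) : ℂ) * Complex.exp (α * Complex.I) := by
  apply Complex.ext
  · rw [Complex.re_ofReal_mul, Complex.exp_ofReal_mul_I_re]
    field_simp
  · rw [Complex.im_ofReal_mul, Complex.exp_ofReal_mul_I_im, Real.tan_eq_sin_div_cos]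
    ring

/-- A geodesic which stays on a line of the plane at distance less than `R * cos (θ / 2)` from the
origin of the exponential map has a homotopically trivial self-intersection. -/
theorem IsExpMap.hasTrivialSelfIntersection (h : IsExpMap ε φ₀ R φ) (h₀ : IsPolarChart θ s ε φ₀)
    (hθ : 0 < θ) (hθ' : θ < π) {g : ℝ → S} (hg : Continuous g) {a t σ x₁ : ℝ}
    (hσ : σ = 1 ∨ σ = -1) (ha : 0 < a) (haR : a < R * Real.cos (θ / 2))
    (hgx : ∀ x, a ^ 2 + (x - x₁) ^ 2 < R ^ 2 → g x = sectorMap φ t ⟨a, σ * (x - x₁)⟩) :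
    HasTrivialSelfIntersection hg := by
  have hcos : 0 < Real.cos (θ / 2) := Real.cos_pos_of_mem_Ioo ⟨by linarith, by linarith⟩
  set w := a * Real.tan (θ / 2) with hw
  set r₁ := a / Real.cos (θ / 2) with hr₁
  have hw0 : 0 < w := mul_pos ha (Real.tan_pos_of_pos_of_lt_pi_div_two (by linarith) (by linarith))
  have hr₁0 : 0 < r₁ := div_pos ha hcos
  have hr₁R : r₁ < R := (div_lt_iff₀ hcos).2 haR
  have hσ2 : σ ^ 2 = 1 := by rcases hσ with rfl | rfl <;> norm_num
  obtain ⟨k, hk⟩ : ∃ k : ℤ, (k : ℝ) = σ := by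
    rcases hσ with rfl | rfl
    · exact ⟨1, by simp⟩
    · exact ⟨-1, by simp⟩
  have hcosα : ∀ β, β = 1 ∨ β = -1 → Real.cos (β * (θ / 2)) = Real.cos (θ / 2) := by
    rintro β (rfl | rfl) <;> simp
  have hmk : ∀ β, β = 1 ∨ β = -1 → (⟨a, β * w⟩ : ℂ) =
      (r₁ : ℂ) * Complex.exp ((β * (θ / 2) : ℝ) * Complex.I) := by
    intro β hβ
    rw [hr₁, ← hcosα β hβ, ← Complex.mk_mul_tan_eq (by rw [hcosα β hβ]; exact hcos.ne')]
    congr 1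
    rcases hβ with rfl | rfl <;> simp [hw]
  have habs : ∀ β : ℝ, β = 1 ∨ β = -1 → |β * (θ / 2)| < π := by
    rintro β (rfl | rfl) <;> simp [abs_of_pos (half_pos hθ)] <;> linarith
  have hnorm : ∀ β, β = 1 ∨ β = -1 → ‖(⟨a, β * w⟩ : ℂ)‖ = r₁ := fun β hβ => by
    rw [hmk β hβ, norm_mul, Complex.norm_exp_ofReal_mul_I, mul_one, Complex.norm_of_nonneg hr₁0.le]
  have harg : ∀ β, β = 1 ∨ β = -1 → (⟨a, β * w⟩ : ℂ).arg = β * (θ / 2) := fun β hβ => by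
    rw [hmk β hβ, arg_ofReal_mul_exp hr₁0 (habs β hβ)]
  have hr₁sq : a ^ 2 + w ^ 2 = r₁ ^ 2 := by
    have := sq_norm_mk a (1 * w)
    rw [hnorm 1 (Or.inl rfl), one_mul] at this
    exact this.symm
  have hσ' : -σ = 1 ∨ -σ = -1 := by rcases hσ with rfl | rfl <;> simp
  let z : unitInterval → ℂ := fun u => ⟨a, σ * ((2 * u - 1) * w)⟩
  have hz0 : z 0 = ⟨a, -σ * w⟩ := by simp [z]
  have hz1 : z 1 = ⟨a, σ * w⟩ := by simp [z]; norm_num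
  have hzc : Continuous z := by
    have : z = fun u : unitInterval =>
        (a : ℂ) + ((σ * ((2 * (u : ℝ) - 1) * w) : ℝ) : ℂ) * Complex.I := by
      funext u
      apply Complex.ext <;> simp [z]
    rw [this]
    fun_prop
  have hzn : ∀ u, ‖z u‖ ≤ r₁ := fun u => by
    refine abs_le_of_sq_le_sq' ?_ hr₁0.le |>.2
    rw [sq_norm_mk, ← hr₁sq, mul_pow, hσ2, one_mul, mul_pow]
    have : (2 * (u : ℝ) - 1) ^ 2 ≤ 1 := by nlinarith [u.2.1, u.2.2]
    nlinarith [sq_nonneg w]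
  let Ψ : C(ℝ × ℝ, S) :=
    { toFun := fun p => φ (projIcc 0 r₁ hr₁0.le p.1) p.2
      continuous_toFun := (h.continuousOn h₀ hθ hθ').comp_continuous
        (f := fun p : ℝ × ℝ => ((projIcc 0 r₁ hr₁0.le p.1 : ℝ), p.2))
        ((continuous_subtype_val.comp (continuous_projIcc.comp continuous_fst)).prodMk
          continuous_snd)
        fun p => ⟨⟨(projIcc 0 r₁ hr₁0.le p.1).2.1,
          (projIcc 0 r₁ hr₁0.le p.1).2.2.trans_lt hr₁R⟩, mem_univ _⟩ }
  let p : Path ((r₁, t + -σ * (θ / 2)) : ℝ × ℝ) (r₁, t + σ * (θ / 2)) :=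
    { toFun := fun u => (‖z u‖, t + (z u).arg)
      continuous_toFun := by
        refine hzc.norm.prodMk (continuous_const.add (continuous_iff_continuousAt.2 fun u => ?_))
        exact (Complex.continuousAt_arg (Or.inl ha)).comp hzc.continuousAt
      source' := by rw [hz0, hnorm _ hσ', harg _ hσ']
      target' := by rw [hz1, hnorm _ hσ, harg _ hσ] }
  have hgu : ∀ u : unitInterval, g (x₁ - w + u * (x₁ + w - (x₁ - w))) = Ψ (p u) := by
    intro u
    have hx : x₁ - w + u * (x₁ + w - (x₁ - w)) - x₁ = (2 * u - 1) * w := by ring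
    have hlt := (sq_le_sq₀ (norm_nonneg _) hr₁0.le).2 (hzn u)
    rw [sq_norm_mk, mul_pow, hσ2, one_mul] at hlt
    rw [hgx _ (by rw [hx]; nlinarith), hx]
    show φ ‖z u‖ (t + (z u).arg) = φ (projIcc 0 r₁ hr₁0.le ‖z u‖) (t + (z u).arg)
    rw [projIcc_of_mem _ ⟨norm_nonneg _, hzn u⟩]
  have hab : ∀ r, Ψ (r, t + -σ * (θ / 2)) = Ψ (r, t + σ * (θ / 2)) := by
    intro r
    have := h.add_period h₀ hθ hθ' (projIcc 0 r₁ hr₁0.le r).2.1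
      ((projIcc 0 r₁ hr₁0.le r).2.2.trans_lt hr₁R) (t + -σ * (θ / 2)) k
    rw [hk, show t + -σ * (θ / 2) + θ * σ = t + σ * (θ / 2) by ring] at this
    exact this.symm
  have heq : g (x₁ + w) = g (x₁ - w) := by
    have e0 := hgu 0
    have e1 := hgu 1
    rw [p.source] at e0
    rw [p.target] at e1
    simp only [Set.Icc.coe_zero, zero_mul, add_zero] at e0
    simp only [Set.Icc.coe_one, one_mul, add_sub_cancel] at e1
    rw [e0, e1, hab]
  refine ⟨x₁ - w, x₁ + w, by linarith, heq, ?_⟩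
  refine Path.homotopic_refl_of_eq_comp _ Ψ (s := s) (fun t => ?_) hab p hgu
  show φ (projIcc 0 r₁ hr₁0.le 0) t = s
  rw [projIcc_left, h.zero h₀]

theorem ESCS.le_dist_of_lt_dist [CompactSpace S] (E : ESCS S) (hs : s ∈ E.conePts)
    (hπ : E.angle s < π) {C : ℝ} (hC0 : 0 < C) (hC : ∀ s' ∈ E.conePts, s' ≠ s → C < dist s s')
    {g : ℝ → S} (hg : Continuous g) (hgeo : IsLocalGeodesic g)
    (htriv : ¬HasTrivialSelfIntersection hg) (t₀ : ℝ) :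
    C * Real.cos (E.angle s / 2) ≤ dist (g t₀) s := by
  by_contra! hlt
  have hθ := E.angle_pos s hs
  obtain ⟨ε₁, φ₀, h₁⟩ := (E.conical s hs).exists_isPolarChart hθ hπ
  have h₀ := h₁.mono hθ hπ (lt_min h₁.pos hC0) (min_le_left _ _)
  obtain ⟨φ, h⟩ := E.exists_isExpMap h₀ hθ hπ (min_le_right _ _) hC
  have hCcos : C * Real.cos (E.angle s / 2) ≤ C :=
    mul_le_of_le_one_right hC0.le (Real.cos_le_one _)
  obtain ⟨ρ, τ, hρ, hρC, hρg⟩ := h.exists_eq_of_dist_lt h₀ hθ hπ E.lengthMetric hlt hCcos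
  obtain rfl | hρ := hρ.eq_or_lt
  · rw [h.zero h₀] at hρg
    exact h₀.ne_center hθ hπ (hgeo t₀) hρg.symm
  rcases h.radial_or_line (I := univ) convex_univ (fun x _ => hgeo x) (mem_univ t₀) hρ
    (hρC.trans_le hCcos) hρg.symm with ⟨σ, hσ, hr⟩ | ⟨a, t, σ, x₁, hσ, ha, haρ, -, hl⟩
  · refine h₀.ne_center hθ hπ (hgeo (t₀ - σ * ρ)) (dist_le_zero.1 ?_)
    have hσ2 : σ * σ = 1 := by rcases hσ with rfl | rfl <;> norm_num
    have hlim : Filter.Tendsto (fun e : ℝ => dist (g (t₀ - σ * ρ + σ * e)) s)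
        (nhdsWithin 0 (Ioi 0)) (nhds (dist (g (t₀ - σ * ρ)) s)) := by
      have hc : Continuous fun e : ℝ => dist (g (t₀ - σ * ρ + σ * e)) s := by fun_prop
      simpa using (hc.tendsto 0).mono_left nhdsWithin_le_nhds
    refine le_of_tendsto_of_tendsto hlim
      (Filter.tendsto_id.mono_left nhdsWithin_le_nhds) ?_
    filter_upwards [Ioo_mem_nhdsGT hρ] with e he
    have hx : ρ + σ * (t₀ - σ * ρ + σ * e - t₀) = e := by linear_combination (e - ρ) * hσ2
    have heC : e < C := he.2.trans (hρC.trans_le hCcos)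
    rw [hr _ (mem_univ _) (by rw [hx]; exact he.1) (by rw [hx]; exact heC), hx]
    exact h.dist_center_le h₀ hθ hπ he.1.le heC τ
  · exact htriv (h.hasTrivialSelfIntersection h₀ hθ hπ hg hσ ha (haρ.trans_lt hρC)
      fun x hx => hl x (mem_univ x) hx)

theorem ESCS.exists_pos_lt_dist (E : ESCS S) (s : S) :
    ∃ C > 0, ∀ s' ∈ E.conePts, s' ≠ s → C < dist s s' := by
  have hev : ∀ᶠ C : ℝ in nhdsWithin 0 (Ioi 0), ∀ s' ∈ E.conePts, s' ≠ s → C < dist s s' := by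
    rw [Finset.eventually_all]
    intro s' _
    by_cases hs : s' = s
    · simp [hs]
    · filter_upwards [Ioo_mem_nhdsGT (dist_pos.2 (Ne.symm hs))] with C hC _ using hC.2
  obtain ⟨C, hC, hC0⟩ := (hev.and self_mem_nhdsWithin).exists
  exact ⟨C, hC0, hC⟩

end Main

/-- if all conical angles lie in `(0,π) ∪ (2π,∞)`, there is a `C > 0`
such that every geodesic with no homotopically trivial self-intersections stays at
distance `≥ C` from every conical point of angle `< 2π`; in fact, for each such
conical point `s` one may take `C = C' cos(θ(s)/2)` whenever `C' > 0` is smaller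
than the distance from `s` to every other conical point. -/
theorem geodesics_avoid_small_cone_points
    {S : Type*} [MetricSpace S] [CompactSpace S] [ConnectedSpace S]
    (E : ESCS S)
    (hangles : ∀ s ∈ E.conePts, E.angle s < Real.pi ∨ 2 * Real.pi < E.angle s) :
    (∃ C > 0, ∀ (g : ℝ → S) (hg : Continuous g), IsLocalGeodesic g →
      ¬HasTrivialSelfIntersection hg →
      ∀ s ∈ E.conePts, E.angle s < 2 * Real.pi → ∀ t : ℝ, C ≤ dist (g t) s) ∧
    (∀ s ∈ E.conePts, E.angle s < 2 * Real.pi → ∀ C' : ℝ, 0 < C' →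
      (∀ s' ∈ E.conePts, s' ≠ s → C' < dist s s') →
      ∀ (g : ℝ → S) (hg : Continuous g), IsLocalGeodesic g →
        ¬HasTrivialSelfIntersection hg →
        ∀ t : ℝ, C' * Real.cos (E.angle s / 2) ≤ dist (g t) s) := by
  have key : ∀ s ∈ E.conePts, E.angle s < 2 * Real.pi → ∀ C' : ℝ, 0 < C' →
      (∀ s' ∈ E.conePts, s' ≠ s → C' < dist s s') →
      ∀ (g : ℝ → S) (hg : Continuous g), IsLocalGeodesic g → ¬HasTrivialSelfIntersection hg →
        ∀ t : ℝ, C' * Real.cos (E.angle s / 2) ≤ dist (g t) s :=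
    fun s hs hlt C' hC' hd g hg hgeo htriv t =>
      E.le_dist_of_lt_dist hs ((hangles s hs).resolve_right hlt.not_gt) hC' hd hg hgeo htriv t
  refine ⟨?_, key⟩
  have hev : ∀ᶠ C : ℝ in nhdsWithin 0 (Ioi 0), ∀ s ∈ E.conePts, E.angle s < 2 * Real.pi →
      ∀ (g : ℝ → S) (hg : Continuous g), IsLocalGeodesic g → ¬HasTrivialSelfIntersection hg →
        ∀ t : ℝ, C ≤ dist (g t) s := by
    rw [Finset.eventually_all]
    intro s hs
    by_cases hlt : E.angle s < 2 * Real.pi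
    · obtain ⟨C', hC', hd⟩ := E.exists_pos_lt_dist s
      have hπ := (hangles s hs).resolve_right hlt.not_gt
      have hθ := E.angle_pos s hs
      have hcos : 0 < Real.cos (E.angle s / 2) :=
        Real.cos_pos_of_mem_Ioo ⟨by linarith, by linarith⟩
      filter_upwards [Ioo_mem_nhdsGT (mul_pos hC' hcos)] with C hC _ g hg hgeo htriv t
      exact hC.2.le.trans (key s hs hlt C' hC' hd g hg hgeo htriv t)
    · exact Filter.Eventually.of_forall fun C h => absurd h hlt
  obtain ⟨C, hC, hC0⟩ := (hev.and self_mem_nhdsWithin).exists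
  exact ⟨C, hC0, fun g hg hgeo htriv s hs hlt t => hC s hs hlt g hg hgeo htriv t⟩

end
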